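/- Let N, N', κ be positive integers with N' ≥ N ≥ 2. Let φ: ℂ^{N−1}×ℝ→ℝ be real-analytic near the origin with φ(0)=0, vanishing first derivatives at 0, and with the Hermitian matrix (∂²φ/∂z_j∂z̄_k(0))_{1≤j,k≤N−1} positive definite, and set M = {(z,w) ∈ ℂ^{N−1}×ℂ : Im w = φ(z, Re w)} (a strictly pseudoconvex real-analytic hypersurface germ through 0 in ℂ^N), with defining function ρ(z,w) = Im w − φ(z, Re w). Let ψ: ℂ^{N'−1}×ℝ→ℝ be real-analytic near the origin with ψ(0)=0, vanishing first derivatives at 0, and set M' = {(Z',w') ∈ ℂ^{N'−1}×ℂ : Im w' = ψ(Z', Re w')}, with defining function ρ'. Let H be holomorphic near 0 ∈ ℂ^N with values in ℂ^{N'}, H(0)=0, with injective differential at 0, mapping all points of M near 0 into M', and κ-nondegenerate at 0, meaning: with the operators L_j := (∂ρ/∂w̄)·∂/∂z̄_j − (∂ρ/∂z̄_j)·∂/∂w̄ (1 ≤ j ≤ N−1) and G := the ℂ^{N'}-valued function given by the Wirtinger gradient of ρ' in all N' complex variables, evaluated at (H, conj H), the values at 0 of G and of all iterated applications of the operators L₁,…,L_{N−1}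 to G of total order at most κ span ℂ^{N'}. Call a tuple (α₁,…,α_{N'}) of functions holomorphic near 0 ∈ ℂ^N, vanishing at 0, an infinitesimal deformation of H if Re(Σ_{j=1}^{N'} α_j·(∂ρ'/∂Z'_j)(H, conj H)) = 0 at every point of M near 0. Then: (i) the ℝ-vector space of germs at 0 of infinitesimal deformations of H is finite-dimensional; and (ii) any two infinitesimal deformations of H whose partial derivatives at 0 agree up to total order 2κ coincide on a neighborhood of 0. -/

import Mathlib

open Complex Filter Topology
open scoped ComplexOrder

/-- Wirtinger derivative in the complex direction `v`:
`∂_v f = ½(∂f/∂x − i·∂f/∂y)`, where `x`,`y` are the real coordinates along `v`, `iv`. -/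
noncomputable def wDer {E F : Type*} [NormedAddCommGroup E] [NormedSpace ℂ E]
    [NormedAddCommGroup F] [NormedSpace ℂ F] (v : E) (f : E → F) (p : E) : F :=
  (2⁻¹ : ℂ) • (fderiv ℝ f p v - Complex.I • fderiv ℝ f p (Complex.I • v))

/-- Conjugate Wirtinger derivative: `∂̄_v f = ½(∂f/∂x + i·∂f/∂y)`. -/
noncomputable def wDerBar {E F : Type*} [NormedAddCommGroup E] [NormedSpace ℂ E]
    [NormedAddCommGroup F] [NormedSpace ℂ F] (v : E) (f : E → F) (p : E) : F :=
  (2⁻¹ : ℂ) • (fderiv ℝ f p v + Complex.I • fderiv ℝ f p (Complex.I • v))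

/-- Wirtinger `z_j`-derivative for functions on `ℂᵏ × ℝ`. -/
noncomputable def wPhiD {k : ℕ} (j : Fin k) (f : (Fin k → ℂ) × ℝ → ℂ)
    (p : (Fin k → ℂ) × ℝ) : ℂ :=
  2⁻¹ * (fderiv ℝ f p (Pi.single j 1, 0) - Complex.I * fderiv ℝ f p (Pi.single j Complex.I, 0))

/-- Conjugate Wirtinger `z̄_j`-derivative for functions on `ℂᵏ × ℝ`. -/
noncomputable def wPhiDBar {k : ℕ} (j : Fin k) (f : (Fin k → ℂ) × ℝ → ℂ)
    (p : (Fin k → ℂ) × ℝ) : ℂ :=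
  2⁻¹ * (fderiv ℝ f p (Pi.single j 1, 0) + Complex.I * fderiv ℝ f p (Pi.single j Complex.I, 0))

/-- The Levi matrix `(∂²φ/∂z_j∂z̄_k(0))_{j,k}`. -/
noncomputable def leviPhi {k : ℕ} (φ : (Fin k → ℂ) × ℝ → ℝ) : Matrix (Fin k) (Fin k) ℂ :=
  fun j j' => wPhiD j (fun p => wPhiDBar j' (fun q => ((φ q : ℝ) : ℂ)) p) 0

/-- The hypersurface `{Im w = φ(z, Re w)} ⊂ ℂᵏ × ℂ`. -/
def MsetN {k : ℕ} (φ : (Fin k → ℂ) × ℝ → ℝ) : Set ((Fin k → ℂ) × ℂ) :=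
  {p | p.2.im = φ (p.1, p.2.re)}

/-- The defining function `ρ(z,w) = Im w − φ(z, Re w)`, complex-valued. -/
noncomputable def rhoCN {k : ℕ} (φ : (Fin k → ℂ) × ℝ → ℝ) : (Fin k → ℂ) × ℂ → ℂ :=
  fun p => ((p.2.im - φ (p.1, p.2.re) : ℝ) : ℂ)

/-- The direction in `ℂ^{N'-1} × ℂ` corresponding to the `j`-th of the `N'` complex
coordinates. -/
noncomputable def gradDir (N' : ℕ) (j : Fin N') : (Fin (N' - 1) → ℂ) × ℂ :=
  if h : (j : ℕ) < N' - 1 then (Pi.single (⟨j, h⟩ : Fin (N' - 1)) 1, 0) else (0, 1)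

/-- The full Wirtinger gradient of `ρ'` in all `N'` complex variables. -/
noncomputable def GgradN (N' : ℕ) (ψ : (Fin (N' - 1) → ℂ) × ℝ → ℝ)
    (q : (Fin (N' - 1) → ℂ) × ℂ) : Fin N' → ℂ :=
  fun j => wDer (gradDir N' j) (rhoCN ψ) q

/-- The CR operator `L_j = (∂ρ/∂w̄)·∂/∂z̄_j − (∂ρ/∂z̄_j)·∂/∂w̄`, acting on vector-valued
functions on `ℂᵏ × ℂ`. -/
noncomputable def LopN {k : ℕ} {F : Type*} [NormedAddCommGroup F] [NormedSpace ℂ F]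
    (φ : (Fin k → ℂ) × ℝ → ℝ) (j : Fin k) (G : (Fin k → ℂ) × ℂ → F) :
    (Fin k → ℂ) × ℂ → F := fun p =>
  (wDerBar ((0 : Fin k → ℂ), (1 : ℂ)) (rhoCN φ) p)
      • wDerBar (Pi.single j 1, (0 : ℂ)) G p
    - (wDerBar (Pi.single j 1, (0 : ℂ)) (rhoCN φ) p)
      • wDerBar ((0 : Fin k → ℂ), (1 : ℂ)) G p



section Prelim

/-- Conjugate of a continuous multilinear map. -/
noncomputable def conjMulti {E F : Type*} [NormedAddCommGroup E] [NormedSpace ℂ E]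
    [StarAddMonoid E] [NormedStarGroup E] [StarModule ℂ E]
    [NormedAddCommGroup F] [NormedSpace ℂ F]
    [StarAddMonoid F] [NormedStarGroup F] [StarModule ℂ F] {n : ℕ}
    (p : ContinuousMultilinearMap ℂ (fun _ : Fin n => E) F) :
    ContinuousMultilinearMap ℂ (fun _ : Fin n => E) F :=
  MultilinearMap.mkContinuous
    { toFun := fun v => star (p (fun i => star (v i)))
      map_update_add' := by
        intro _ m i x y
        have h : ∀ z : E, (fun j => star (Function.update m i z j))
            = Function.update (fun j => star (m j)) i (star z) := by
          intro z
          funext j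
          by_cases hj : j = i
          · subst hj; simp [Function.update]
          · simp [Function.update, hj]
        have h2 : ∀ (inst : DecidableEq (Fin n)) (z : E), (fun j => star (@Function.update _ _ inst m i z j))
            = @Function.update _ _ inst (fun j => star (m j)) i (star z) := by
          intro inst z
          funext j
          by_cases hj : j = i
          · subst hj; simp [Function.update]
          · simp [Function.update, hj]
        simp only [h2, star_add, ContinuousMultilinearMap.map_update_add]
      map_update_smul' := by
        intro _ m i c x
        have h2 : ∀ (inst : DecidableEq (Fin n)) (z : E), (fun j => star (@Function.update _ _ inst m i z j))
            = @Function.update _ _ inst (fun j => star (m j)) i (star z) := by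
          intro inst z
          funext j
          by_cases hj : j = i
          · subst hj; simp [Function.update]
          · simp [Function.update, hj]
        simp only [h2, star_smul, ContinuousMultilinearMap.map_update_smul, star_star] }
    ‖p‖ (by
      intro v
      simp only [MultilinearMap.coe_mk, norm_star]
      refine (p.le_opNorm _).trans (le_of_eq ?_)
      simp [norm_star])

lemma conjMulti_apply {E F : Type*} [NormedAddCommGroup E] [NormedSpace ℂ E]
    [StarAddMonoid E] [NormedStarGroup E] [StarModule ℂ E]
    [NormedAddCommGroup F] [NormedSpace ℂ F]
    [StarAddMonoid F] [NormedStarGroup F] [StarModule ℂ F] {n : ℕ}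
    (p : ContinuousMultilinearMap ℂ (fun _ : Fin n => E) F) (v : Fin n → E) :
    conjMulti p v = star (p (fun i => star (v i))) := rfl

lemma norm_conjMulti_le {E F : Type*} [NormedAddCommGroup E] [NormedSpace ℂ E]
    [StarAddMonoid E] [NormedStarGroup E] [StarModule ℂ E]
    [NormedAddCommGroup F] [NormedSpace ℂ F]
    [StarAddMonoid F] [NormedStarGroup F] [StarModule ℂ F] {n : ℕ}
    (p : ContinuousMultilinearMap ℂ (fun _ : Fin n => E) F) :
    ‖conjMulti p‖ ≤ ‖p‖ :=
  MultilinearMap.mkContinuous_norm_le _ (norm_nonneg _) _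

lemma analyticAt_star_star {E F : Type*} [NormedAddCommGroup E] [NormedSpace ℂ E]
    [StarAddMonoid E] [NormedStarGroup E] [StarModule ℂ E]
    [NormedAddCommGroup F] [NormedSpace ℂ F]
    [StarAddMonoid F] [NormedStarGroup F] [StarModule ℂ F] {f : E → F}
    (hf : AnalyticAt ℂ f 0) : AnalyticAt ℂ (fun x => star (f (star x))) 0 := by
  obtain ⟨p, r, hp⟩ := hf
  refine ⟨fun n => conjMulti (p n), r, ?_, hp.r_pos, ?_⟩
  · refine hp.r_le.trans ?_
    refine FormalMultilinearSeries.radius_le_of_le ?_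
    intro n
    exact norm_conjMulti_le _
  · intro y hy
    have hy' : star y ∈ Metric.eball (0 : E) r := by
      simpa [Metric.mem_eball, edist_zero_right, enorm_eq_nnnorm] using hy
    have h := hp.hasSum hy'
    have h2 := h.map (starAddEquiv (R := F)) continuous_star
    simpa [Function.comp_def, conjMulti_apply] using h2

/-- Complexified power series in coordinates. -/
noncomputable def cser {ι E F : Type*} [Fintype ι] [NormedAddCommGroup E] [NormedSpace ℝ E]
    [NormedAddCommGroup F] [NormedSpace ℂ F] [NormedSpace ℝ F] (b : ι → E)
    (p : FormalMultilinearSeries ℝ E F) : FormalMultilinearSeries ℂ (ι → ℂ) F :=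
  fun n => ∑ i : Fin n → ι,
    ((ContinuousMultilinearMap.mkPiAlgebra ℂ (Fin n) ℂ).compContinuousLinearMap
      (fun k => ContinuousLinearMap.proj (R := ℂ) (φ := fun _ : ι => ℂ) (i k))).smulRight
      (p n (fun k => b (i k)))

lemma cser_apply {ι E F : Type*} [Fintype ι] [NormedAddCommGroup E] [NormedSpace ℝ E]
    [NormedAddCommGroup F] [NormedSpace ℂ F] [NormedSpace ℝ F] (b : ι → E)
    (p : FormalMultilinearSeries ℝ E F) (n : ℕ) (v : Fin n → ι → ℂ) :
    cser b p n v = ∑ i : Fin n → ι, (∏ k, v k (i k)) • p n (fun k => b (i k)) := by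
  simp [cser]

lemma cser_norm_le {ι E F : Type*} [Fintype ι] [NormedAddCommGroup E] [NormedSpace ℝ E]
    [NormedAddCommGroup F] [NormedSpace ℂ F] [NormedSpace ℝ F] (b : ι → E)
    (p : FormalMultilinearSeries ℝ E F) (B : ℝ) (hB : ∀ i, ‖b i‖ ≤ B) (n : ℕ) :
    ‖cser b p n‖ ≤ (Fintype.card ι : ℝ) ^ n * (‖p n‖ * B ^ n) := by
  by_cases hι : Nonempty ι
  · have hB0 : 0 ≤ B := (norm_nonneg _).trans (hB hι.some)
    refine ContinuousMultilinearMap.opNorm_le_bound (by positivity) ?_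
    intro v
    rw [cser_apply]
    have : ∀ i : Fin n → ι, ‖(∏ k, v k (i k)) • p n (fun k => b (i k))‖
        ≤ (‖p n‖ * B ^ n) * ∏ k, ‖v k‖ := by
      intro i
      rw [norm_smul, mul_comm, norm_prod]
      have h1 : ‖p n (fun k => b (i k))‖ ≤ ‖p n‖ * B ^ n := by
        refine ((p n).le_opNorm _).trans ?_
        gcongr
        calc ∏ k : Fin n, ‖b (i k)‖ ≤ ∏ k : Fin n, B :=
              Finset.prod_le_prod (fun _ _ => norm_nonneg _) (fun _ _ => hB _)
          _ = B ^ n := by simp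
      have h2 : ∏ k, ‖v k (i k)‖ ≤ ∏ k, ‖v k‖ :=
        Finset.prod_le_prod (fun _ _ => norm_nonneg _) (fun k _ => norm_le_pi_norm (v k) (i k))
      gcongr
    refine (norm_sum_le _ _).trans ((Finset.sum_le_sum (fun i _ => this i)).trans (le_of_eq ?_))
    simp [mul_assoc]
  · have : IsEmpty ι := not_nonempty_iff.mp hι
    rcases n with _ | n
    · refine ContinuousMultilinearMap.opNorm_le_bound (by positivity) ?_
      intro v
      rw [cser_apply]
      refine (norm_sum_le _ _).trans ?_
      simp
    · have : IsEmpty (Fin (n+1) → ι) := ⟨fun f => IsEmpty.false (f 0)⟩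
      simp [cser]

lemma exists_complexify_coord {ι E F : Type*} [Fintype ι] [NormedAddCommGroup E] [NormedSpace ℝ E]
    [NormedAddCommGroup F] [NormedSpace ℂ F] [NormedSpace ℝ F] [IsScalarTower ℝ ℂ F] [CompleteSpace F]
    (b : Module.Basis ι ℝ E) (f : E → F) (hf : AnalyticAt ℝ f 0) :
    ∃ g : (ι → ℂ) → F, AnalyticAt ℂ g 0 ∧
      ∀ᶠ x in 𝓝 (0 : E), f x = g (fun i => ((b.repr x i : ℝ) : ℂ)) := by
  obtain ⟨p, r, hp⟩ := hf
  have hfin : FiniteDimensional ℝ E := b.finiteDimensional_of_finite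
  obtain ⟨C, a, hC, ha, hpa⟩ := p.le_mul_pow_of_radius_pos (hp.r_pos.trans_le hp.r_le)
  obtain ⟨B, hB1, hB⟩ : ∃ B : ℝ, 1 ≤ B ∧ ∀ i, ‖b i‖ ≤ B :=
    ⟨1 + ∑ i, ‖b i‖, by simpa using Finset.sum_nonneg (fun i _ => norm_nonneg (b i)), fun i => by
      have := Finset.single_le_sum (f := fun i => ‖b i‖) (fun i _ => norm_nonneg (b i)) (Finset.mem_univ i)
      linarith⟩
  set q := cser b p with hq
  have hB0 : 0 < B := by linarith
  set D : ℝ := (Fintype.card ι + 1) * a * B with hD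
  have hD0 : 0 < D := by positivity
  have hrad : 0 < q.radius := by
    have : ((Real.toNNReal D⁻¹ : NNReal) : ENNReal) ≤ q.radius := by
      refine q.le_radius_of_bound C ?_
      intro n
      have h1 := cser_norm_le b p B hB n
      have h2 : ‖q n‖ ≤ C * D ^ n := by
        refine h1.trans ?_
        calc (Fintype.card ι : ℝ) ^ n * (‖p n‖ * B ^ n)
            ≤ (Fintype.card ι + 1 : ℝ) ^ n * ((C * a ^ n) * B ^ n) := by
              gcongr
              · linarith
              · exact hpa n
          _ = C * D ^ n := by rw [hD, mul_pow, mul_pow]; ring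
      rw [Real.coe_toNNReal _ (by positivity)]
      calc ‖q n‖ * D⁻¹ ^ n ≤ C * D ^ n * D⁻¹ ^ n := by gcongr
        _ = C := by rw [mul_assoc, ← mul_pow, mul_inv_cancel₀ hD0.ne', one_pow, mul_one]
    refine lt_of_lt_of_le ?_ this
    simpa using hD0
  have hqs := q.hasFPowerSeriesOnBall hrad
  refine ⟨q.sum, ⟨q, hqs.hasFPowerSeriesAt⟩, ?_⟩
  have hcont : Continuous (fun x : E => (fun i => ((b.repr x i : ℝ) : ℂ) : ι → ℂ)) := by
    refine continuous_pi fun i => ?_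
    exact Complex.continuous_ofReal.comp (LinearMap.continuous_of_finiteDimensional (b.coord i))
  have h0 : (fun i => ((b.repr (0:E) i : ℝ) : ℂ) : ι → ℂ) = 0 := by funext i; simp
  have hev1 : ∀ᶠ x in 𝓝 (0 : E), (fun i => ((b.repr x i : ℝ) : ℂ) : ι → ℂ) ∈ Metric.eball (0 : ι → ℂ) q.radius := by
    refine hcont.continuousAt.eventually_mem ?_
    rw [h0]
    exact Metric.eball_mem_nhds _ hrad
  filter_upwards [hev1, Metric.eball_mem_nhds (0 : E) hp.r_pos] with x hx1 hx2
  have s1 := hp.hasSum hx2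
  have s2 := hqs.hasSum hx1
  rw [zero_add] at s1 s2
  refine s1.unique ?_
  convert s2 using 1
  funext n
  rw [cser_apply]
  conv_lhs => rw [← b.sum_repr x]
  rw [(p n).map_sum]
  refine Finset.sum_congr rfl fun i _ => ?_
  rw [(p n).map_smul_univ]
  rw [← Complex.ofReal_prod]
  exact (algebraMap_smul ℂ (∏ k, b.repr x (i k)) ((p n) fun k => b (i k))).symm

lemma exists_complexify {E F : Type*} [NormedAddCommGroup E] [NormedSpace ℂ E]
    [StarAddMonoid E] [NormedStarGroup E] [StarModule ℂ E] [FiniteDimensional ℂ E]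
    [NormedAddCommGroup F] [NormedSpace ℂ F] [CompleteSpace F]
    (f : E → F) (hf : AnalyticAt ℝ f 0) :
    ∃ g : E × E → F, AnalyticAt ℂ g 0 ∧ ∀ᶠ x in 𝓝 (0 : E), f x = g (x, star x) := by
  have : FiniteDimensional ℝ E := FiniteDimensional.complexToReal E
  let b := Module.finBasis ℝ E
  obtain ⟨g, hg, hfg⟩ := exists_complexify_coord b f hf
  let lam : Fin (Module.finrank ℝ E) → E →ₗ[ℝ] ℝ := fun i => b.coord i
  let mu : Fin (Module.finrank ℝ E) → E →ₗ[ℂ] ℂ := fun i => Module.Dual.extendRCLike (lam i)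
  let J : E × E →ₗ[ℂ] (Fin (Module.finrank ℝ E) → ℂ) :=
    { toFun := fun X i => 2⁻¹ * (mu i X.1 + star (mu i (star X.2)))
      map_add' := by
        intro X Y
        funext i
        simp
        ring
      map_smul' := by
        intro c X
        funext i
        simp [star_smul]
        ring }
  have hJ : ∀ x : E, J (x, star x) = fun i => ((b.repr x i : ℝ) : ℂ) := by
    intro x
    funext i
    simp only [J, LinearMap.coe_mk, AddHom.coe_mk, star_star]
    have : (mu i x).re = b.repr x i := by
      simp [mu, lam, Module.Dual.extendRCLike_apply]
    rw [← this]
    apply Complex.ext <;> simp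
    ring
  refine ⟨fun X => g (J X), ?_, ?_⟩
  · have h1 : AnalyticAt ℂ (fun X => J X) 0 := (LinearMap.toContinuousLinearMap J).analyticAt 0
    refine AnalyticAt.fun_comp (g := g) (f := fun X => J X) ?_ h1
    simpa using hg
  · filter_upwards [hfg] with x hx
    rw [hJ, hx]

/-- Uniqueness: a holomorphic function vanishing on a totally real subspace vanishes. -/
lemma eventually_zero_of_real {V F : Type*} [NormedAddCommGroup V] [NormedSpace ℂ V]
    [NormedAddCommGroup F] [NormedSpace ℂ F] [CompleteSpace F] (σ : V → V) (hadd : ∀ x y, σ (x + y) = σ x + σ y)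
    (hsmul : ∀ (c : ℂ) x, σ (c • x) = star c • σ x) (hnorm : ∀ x, ‖σ x‖ = ‖x‖)
    (hinv : ∀ x, σ (σ x) = x) (g : V → F) (hg : AnalyticAt ℂ g 0)
    (h0 : ∀ᶠ x in 𝓝 (0 : V), σ x = x → g x = 0) : ∀ᶠ x in 𝓝 (0 : V), g x = 0 := by
  obtain ⟨r, hr, hball⟩ := Metric.eventually_nhds_iff_ball.mp (hg.eventually_analyticAt.and h0)
  refine Metric.eventually_nhds_iff_ball.mpr ⟨r, hr, ?_⟩
  intro v hv
  set x : V := (2⁻¹ : ℂ) • (v + σ v) with hx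
  set y : V := (-(Complex.I * 2⁻¹) : ℂ) • (v - σ v) with hy
  have hneg : ∀ u, σ (-u) = - σ u := by
    intro u
    have := hsmul (-1) u
    simpa using this
  have hσx : σ x = x := by
    rw [hx, hsmul, hadd, hinv, add_comm]; simp
  have hσy : σ y = y := by
    rw [hy, hsmul, sub_eq_add_neg, hadd, hneg, hinv]
    simp only [star_neg, star_mul', star_inv₀]
    simp only [RCLike.star_def, conj_I, map_ofNat]
    module
  have hvxy : v = x + Complex.I • y := by
    rw [hx, hy, smul_smul]
    have : Complex.I * -(Complex.I * 2⁻¹) = 2⁻¹ := by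
      rw [mul_neg, ← mul_assoc, Complex.I_mul_I]; ring
    rw [this]; module
  have hxn : ‖x‖ ≤ ‖v‖ := by
    rw [hx, norm_smul]
    have := norm_add_le v (σ v)
    rw [hnorm] at this
    simp
    linarith
  rw [mem_ball_zero_iff] at hv
  let U : Set ℂ := (fun t : ℂ => x + t • y) ⁻¹' Metric.ball (0 : V) r
  have hUconv : Convex ℝ U := by
    intro a ha c hc s t hs ht hst
    have h := (convex_ball (0 : V) r) ha hc hs ht hst
    change x + (s • a + t • c) • y ∈ Metric.ball (0 : V) r
    convert h using 1
    have e : x = s • x + t • x := by rw [← add_smul, hst, one_smul]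
    rw [smul_add, smul_add, add_smul, smul_assoc, smul_assoc]
    nth_rewrite 1 [e]
    abel
  have hUan : AnalyticOnNhd ℂ (fun t : ℂ => g (x + t • y)) U := by
    intro t ht
    have h1 : AnalyticAt ℂ g (x + t • y) := (hball _ ht).1
    refine AnalyticAt.fun_comp (g := g) (f := fun t : ℂ => x + t • y) h1 ?_
    fun_prop
  have h0U : (0 : ℂ) ∈ U := by
    change x + (0 : ℂ) • y ∈ Metric.ball (0 : V) r
    rw [zero_smul, add_zero, mem_ball_zero_iff]
    exact hxn.trans_lt hv
  have hIU : Complex.I ∈ U := by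
    change x + Complex.I • y ∈ Metric.ball (0 : V) r
    rw [← hvxy, mem_ball_zero_iff]; exact hv
  have hUo : IsOpen U := Metric.isOpen_ball.preimage (by fun_prop)
  have hreal : ∀ t : ℝ, (t : ℂ) ∈ U → g (x + (t : ℂ) • y) = 0 := by
    intro t ht
    refine (hball _ ht).2 ?_
    change σ (x + (t : ℂ) • y) = x + (t : ℂ) • y
    rw [hadd x, hsmul (t : ℂ) y, hσx, hσy]; simp
  have hfreq : ∃ᶠ t in 𝓝[≠] (0 : ℂ), (fun t : ℂ => g (x + t • y)) t = 0 := by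
    have ht : Tendsto (fun t : ℝ => (t : ℂ)) (𝓝[≠] 0) (𝓝[≠] 0) := by
      refine tendsto_nhdsWithin_iff.mpr ⟨?_, ?_⟩
      · exact (Complex.continuous_ofReal.tendsto' 0 0 (by simp)).mono_left nhdsWithin_le_nhds
      · filter_upwards [self_mem_nhdsWithin] with t ht
        simpa using ht
    refine ht.frequently (Eventually.frequently ?_)
    have : ∀ᶠ t : ℝ in 𝓝[≠] 0, (t : ℂ) ∈ U :=
      ht.eventually (mem_nhdsWithin_of_mem_nhds (hUo.mem_nhds h0U))
    filter_upwards [this] with t ht using hreal t ht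
  have := hUan.eqOn_zero_of_preconnected_of_frequently_eq_zero hUconv.isPreconnected h0U hfreq hIU
  rw [hvxy]
  simpa using this

/-- Cauchy: a directional derivative lowers the vanishing order by one. -/
lemma isBigO_fderiv {V F : Type*} [NormedAddCommGroup V] [NormedSpace ℂ V]
    [NormedAddCommGroup F] [NormedSpace ℂ F] [CompleteSpace F] {f : V → F} {x₀ : V} (hf : AnalyticAt ℂ f x₀)
    {m : ℕ} (h : f =O[𝓝 x₀] fun x => ‖x - x₀‖ ^ (m + 1)) (v : V) :
    (fun x => fderiv ℂ f x v) =O[𝓝 x₀] fun x => ‖x - x₀‖ ^ m := by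
  rcases m with _ | m
  · simp only [pow_zero]
    have : ContinuousAt (fun x => fderiv ℂ f x v) x₀ :=
      (hf.fderiv.continuousAt).clm_apply continuousAt_const
    exact this.isBigO_one (F := ℝ)
  · obtain ⟨C, hC, hb⟩ := h.exists_pos
    have hb' := hb.bound
    obtain ⟨r, hr, hball⟩ := Metric.eventually_nhds_iff_ball.mp (hf.eventually_analyticAt.and hb')
    have hd0 : fderiv ℂ f x₀ = 0 := (h.hasFDerivAt (by omega)).fderiv
    refine Asymptotics.IsBigO.of_bound (C * (1 + ‖v‖) ^ (m + 1 + 1)) ?_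
    refine Metric.eventually_nhds_iff_ball.mpr ⟨r / (1 + ‖v‖), by positivity, ?_⟩
    intro x hx
    rw [Metric.mem_ball, dist_eq_norm, lt_div_iff₀ (by positivity)] at hx
    by_cases hxx : x = x₀
    · subst hxx
      simp [hd0]
    set R := ‖x - x₀‖ with hR
    have hR0 : 0 < R := norm_pos_iff.mpr (sub_ne_zero.mpr hxx)
    have key : ∀ t : ℂ, ‖t‖ ≤ R → ‖x + t • v - x₀‖ ≤ R * (1 + ‖v‖) := by
      intro t ht
      calc ‖x + t • v - x₀‖ = ‖(x - x₀) + t • v‖ := by congr 1; abel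
        _ ≤ R + ‖t‖ * ‖v‖ := by rw [← norm_smul]; exact norm_add_le _ _
        _ ≤ R + R * ‖v‖ := by gcongr
        _ = _ := by ring
    have keyb : ∀ t : ℂ, ‖t‖ ≤ R → x + t • v ∈ Metric.ball x₀ r := by
      intro t ht
      rw [Metric.mem_ball, dist_eq_norm]
      exact (key t ht).trans_lt hx
    have hder : deriv (fun t : ℂ => f (x + t • v)) 0 = fderiv ℂ f x v := by
      have h1 : HasFDerivAt f (fderiv ℂ f x) (x + (0:ℂ) • v) := by
        have := (hball _ (keyb 0 (by simp [hR0.le]))).1.differentiableAt.hasFDerivAt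
        simpa using this
      have h2 : HasDerivAt (fun t : ℂ => x + t • v) v 0 := by
        simpa using ((hasDerivAt_id (0:ℂ)).smul_const v).const_add x
      exact (h1.comp_hasDerivAt (0:ℂ) h2).deriv
    have hdiff : DiffContOnCl ℂ (fun t : ℂ => f (x + t • v)) (Metric.ball 0 R) := by
      refine DifferentiableOn.diffContOnCl ?_
      rw [closure_ball _ hR0.ne']
      intro t ht
      have h1 := (hball _ (keyb t (by simpa using ht))).1.differentiableAt
      have h2 : DifferentiableAt ℂ (fun t : ℂ => x + t • v) t := by fun_prop
      exact (DifferentiableAt.comp t h1 h2).differentiableWithinAt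
    have := Complex.norm_deriv_le_of_forall_mem_sphere_norm_le (C := C * (R * (1 + ‖v‖)) ^ (m+1+1)) hR0 hdiff (by
      intro t ht
      have ht' : ‖t‖ = R := by simpa using ht
      refine ((hball _ (keyb t ht'.le)).2).trans ?_
      rw [norm_pow, norm_norm]
      gcongr
      exact key t ht'.le)
    rw [hder] at this
    refine this.trans (le_of_eq ?_)
    rw [norm_pow, Real.norm_of_nonneg hR0.le, mul_pow]
    field_simp
    ring

end Prelim


section Operators

lemma wirtinger_of_complexify {E F : Type*} [NormedAddCommGroup E] [NormedSpace ℂ E]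
    [StarAddMonoid E] [NormedStarGroup E] [StarModule ℂ E]
    [NormedAddCommGroup F] [NormedSpace ℂ F] {f : E → F} {g : E × E → F} {p : E}
    (hg : DifferentiableAt ℂ g (p, star p)) (h : ∀ᶠ x in 𝓝 p, f x = g (x, star x)) (v : E) :
    wDerBar v f p = fderiv ℂ g (p, star p) (0, star v) ∧
    wDer v f p = fderiv ℂ g (p, star p) (v, 0) := by
  have h1 : HasFDerivAt g ((fderiv ℂ g (p, star p)).restrictScalars ℝ) (p, star p) :=
    hg.hasFDerivAt.restrictScalars ℝ
  let S : E →L[ℝ] E × E := (ContinuousLinearMap.id ℝ E).prod ((starL' ℝ : E ≃L[ℝ] E) : E →L[ℝ] E)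
  have h2 : HasFDerivAt (fun x : E => (x, star x)) S p := S.hasFDerivAt (x := p)
  have h3 : HasFDerivAt (fun x : E => g (x, star x)) (((fderiv ℂ g (p, star p)).restrictScalars ℝ).comp S) p :=
    HasFDerivAt.comp p h1 h2
  have h4 : fderiv ℝ f p = ((fderiv ℂ g (p, star p)).restrictScalars ℝ).comp S :=
    (h3.congr_of_eventuallyEq h).fderiv
  have h5 : ∀ u, fderiv ℝ f p u = fderiv ℂ g (p, star p) (u, star u) := by
    intro u; rw [h4]; rfl
  set D := fderiv ℂ g (p, star p)
  have h6 : ∀ u : E, Complex.I • D (Complex.I • u, star (Complex.I • u)) = D (-u, star u) := by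
    intro u
    rw [← D.map_smul]
    congr 1
    ext
    · simp [smul_smul]
    · simp [star_smul, smul_smul]
  refine ⟨?_, ?_⟩
  · rw [wDerBar, h5, h5, h6, ← D.map_add, ← D.map_smul]
    congr 1
    ext
    · simp
    · simp only [Prod.smul_snd, Prod.snd_add]; module
  · rw [wDer, h5, h5, h6, ← D.map_sub, ← D.map_smul]
    congr 1
    ext
    · simp only [Prod.smul_fst, Prod.fst_sub]; module
    · simp

/-- Complexified defining function. -/
noncomputable def rhoC {k : ℕ} (Φ : (Fin k → ℂ) × (Fin k → ℂ) × ℂ → ℂ)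
    (X : ((Fin k → ℂ) × ℂ) × ((Fin k → ℂ) × ℂ)) : ℂ :=
  -(Complex.I / 2) * (X.1.2 - X.2.2) - Φ (X.1.1, X.2.1, 2⁻¹ * (X.1.2 + X.2.2))

/-- Parametrization of the complexified hypersurface. -/
noncomputable def parC {k : ℕ} (Φ : (Fin k → ℂ) × (Fin k → ℂ) × ℂ → ℂ)
    (x : (Fin k → ℂ) × (Fin k → ℂ) × ℂ) : ((Fin k → ℂ) × ℂ) × ((Fin k → ℂ) × ℂ) :=
  ((x.1, x.2.2 + Complex.I * Φ x), (x.2.1, x.2.2 - Complex.I * Φ x))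

/-- Complexified CR operator. -/
noncomputable def LC {k : ℕ} {F : Type*} [NormedAddCommGroup F] [NormedSpace ℂ F]
    (ρ : ((Fin k → ℂ) × ℂ) × ((Fin k → ℂ) × ℂ) → ℂ) (j : Fin k)
    (f : ((Fin k → ℂ) × ℂ) × ((Fin k → ℂ) × ℂ) → F)
    (X : ((Fin k → ℂ) × ℂ) × ((Fin k → ℂ) × ℂ)) : F :=
  fderiv ℂ ρ X (0, (0, 1)) • fderiv ℂ f X (0, (Pi.single j 1, 0))
    - fderiv ℂ ρ X (0, (Pi.single j 1, 0)) • fderiv ℂ f X (0, (0, 1))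

lemma analyticAt_fderiv_apply {V F : Type*} [NormedAddCommGroup V] [NormedSpace ℂ V]
    [NormedAddCommGroup F] [NormedSpace ℂ F] [CompleteSpace F] {f : V → F} {x : V}
    (hf : AnalyticAt ℂ f x) (v : V) : AnalyticAt ℂ (fun y => fderiv ℂ f y v) x := by
  exact ((ContinuousLinearMap.apply ℂ F v).analyticAt _).fun_comp hf.fderiv

lemma analyticAt_of_linear {V W : Type*} [NormedAddCommGroup V] [NormedSpace ℂ V]
    [NormedAddCommGroup W] [NormedSpace ℂ W] [FiniteDimensional ℂ V] (f : V → W)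
    (hadd : ∀ x y, f (x + y) = f x + f y) (hsmul : ∀ (c : ℂ) x, f (c • x) = c • f x) (x : V) :
    AnalyticAt ℂ f x :=
  (LinearMap.toContinuousLinearMap
    ({ toFun := f, map_add' := hadd, map_smul' := hsmul } : V →ₗ[ℂ] W)).analyticAt x

lemma analyticAt_rhoC {k : ℕ} {Φ : (Fin k → ℂ) × (Fin k → ℂ) × ℂ → ℂ}
    {X : ((Fin k → ℂ) × ℂ) × ((Fin k → ℂ) × ℂ)}
    (hΦ : AnalyticAt ℂ Φ (X.1.1, X.2.1, 2⁻¹ * (X.1.2 + X.2.2))) : AnalyticAt ℂ (rhoC Φ) X := by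
  unfold rhoC
  refine AnalyticAt.fun_sub (analyticAt_of_linear _
    (by intro X Y; simp; ring) (by intro c X; simp; ring) _) ?_
  refine AnalyticAt.fun_comp (g := Φ) (f := fun X : ((Fin k → ℂ) × ℂ) × ((Fin k → ℂ) × ℂ) =>
    (X.1.1, X.2.1, 2⁻¹ * (X.1.2 + X.2.2))) hΦ ?_
  exact analyticAt_of_linear _
    (by intro X Y; ext <;> simp; ring) (by intro c X; ext <;> simp; ring) _

lemma hasFDerivAt_rhoC {k : ℕ} {Φ : (Fin k → ℂ) × (Fin k → ℂ) × ℂ → ℂ}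
    {X : ((Fin k → ℂ) × ℂ) × ((Fin k → ℂ) × ℂ)}
    (hΦ : DifferentiableAt ℂ Φ (X.1.1, X.2.1, 2⁻¹ * (X.1.2 + X.2.2)))
    (v : ((Fin k → ℂ) × ℂ) × ((Fin k → ℂ) × ℂ)) :
    fderiv ℂ (rhoC Φ) X v = -(Complex.I / 2) * (v.1.2 - v.2.2)
      - fderiv ℂ Φ (X.1.1, X.2.1, 2⁻¹ * (X.1.2 + X.2.2)) (v.1.1, v.2.1, 2⁻¹ * (v.1.2 + v.2.2)) := by
  let A : ((Fin k → ℂ) × ℂ) × ((Fin k → ℂ) × ℂ) →ₗ[ℂ] (Fin k → ℂ) × (Fin k → ℂ) × ℂ :=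
    { toFun := fun X => (X.1.1, X.2.1, 2⁻¹ * (X.1.2 + X.2.2))
      map_add' := by intro X Y; ext <;> simp; ring
      map_smul' := by intro c X; ext <;> simp; ring }
  let B : ((Fin k → ℂ) × ℂ) × ((Fin k → ℂ) × ℂ) →ₗ[ℂ] ℂ :=
    { toFun := fun X => -(Complex.I / 2) * (X.1.2 - X.2.2)
      map_add' := by intro X Y; simp; ring
      map_smul' := by intro c X; simp; ring }
  have hA : HasFDerivAt (fun X => A X) (LinearMap.toContinuousLinearMap A) X :=
    (LinearMap.toContinuousLinearMap A).hasFDerivAt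
  have hB : HasFDerivAt (fun X => B X) (LinearMap.toContinuousLinearMap B) X :=
    (LinearMap.toContinuousLinearMap B).hasFDerivAt
  have h2 : HasFDerivAt (fun X => Φ (A X)) ((fderiv ℂ Φ (A X)).comp (LinearMap.toContinuousLinearMap A)) X :=
    HasFDerivAt.comp X hΦ.hasFDerivAt hA
  have h3 := (hB.sub h2).fderiv
  have h4 : rhoC Φ = fun X => B X - Φ (A X) := rfl
  have h5 : ((fun X => B X) - fun X => Φ (A X)) = rhoC Φ := rfl
  rw [h5] at h3
  rw [h3]
  rfl

lemma rhoC_parC {k : ℕ} (Φ : (Fin k → ℂ) × (Fin k → ℂ) × ℂ → ℂ)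
    (x : (Fin k → ℂ) × (Fin k → ℂ) × ℂ) : rhoC Φ (parC Φ x) = 0 := by
  have h : (2⁻¹ : ℂ) * (x.2.2 + Complex.I * Φ x + (x.2.2 - Complex.I * Φ x)) = x.2.2 := by ring
  simp only [rhoC, parC, h]
  have : (x.1, x.2.1, x.2.2) = x := rfl
  rw [this]
  linear_combination (-Φ x) * Complex.I_mul_I

lemma parC_of_rhoC {k : ℕ} (Φ : (Fin k → ℂ) × (Fin k → ℂ) × ℂ → ℂ)
    (X : ((Fin k → ℂ) × ℂ) × ((Fin k → ℂ) × ℂ)) (h : rhoC Φ X = 0) :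
    parC Φ (X.1.1, X.2.1, 2⁻¹ * (X.1.2 + X.2.2)) = X := by
  have h2 : Φ (X.1.1, X.2.1, 2⁻¹ * (X.1.2 + X.2.2)) = -(Complex.I / 2) * (X.1.2 - X.2.2) := by
    rw [rhoC] at h
    exact (sub_eq_zero.mp h).symm
  obtain ⟨⟨z, w⟩, ⟨χ, τ⟩⟩ := X
  simp only [parC]
  simp only at h2
  rw [h2]
  refine Prod.ext (Prod.ext rfl ?_) (Prod.ext rfl ?_)
  · simp only
    linear_combination (-(w - τ) / 2) * Complex.I_mul_I
  · simp only
    linear_combination ((w - τ) / 2) * Complex.I_mul_I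

lemma continuousAt_parC {k : ℕ} {Φ : (Fin k → ℂ) × (Fin k → ℂ) × ℂ → ℂ}
    (hΦ : AnalyticAt ℂ Φ 0) : AnalyticAt ℂ (parC Φ) 0 := by
  unfold parC
  have h1 : AnalyticAt ℂ (fun x : (Fin k → ℂ) × (Fin k → ℂ) × ℂ => x.1) 0 :=
    analyticAt_of_linear _ (by intro X Y; simp) (by intro c X; simp) _
  have h2 : AnalyticAt ℂ (fun x : (Fin k → ℂ) × (Fin k → ℂ) × ℂ => x.2.1) 0 :=
    analyticAt_of_linear _ (by intro X Y; simp) (by intro c X; simp) _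
  have h3 : AnalyticAt ℂ (fun x : (Fin k → ℂ) × (Fin k → ℂ) × ℂ => x.2.2) 0 :=
    analyticAt_of_linear _ (by intro X Y; simp) (by intro c X; simp) _
  exact (h1.prod (h3.fun_add (analyticAt_const.fun_mul hΦ))).prod
    (h2.prod (h3.fun_sub (analyticAt_const.fun_mul hΦ)))

lemma parC_zero {k : ℕ} {Φ : (Fin k → ℂ) × (Fin k → ℂ) × ℂ → ℂ} (h0 : Φ 0 = 0) :
    parC Φ 0 = 0 := by
  simp [parC, h0]

lemma LC_tangent {k : ℕ} {Φ : (Fin k → ℂ) × (Fin k → ℂ) × ℂ → ℂ}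
    (hΦ : AnalyticAt ℂ Φ 0) (h0 : Φ 0 = 0) (j : Fin k)
    {f : ((Fin k → ℂ) × ℂ) × ((Fin k → ℂ) × ℂ) → ℂ} (hf : AnalyticAt ℂ f 0)
    (hz : ∀ᶠ x in 𝓝 0, f (parC Φ x) = 0) :
    ∀ᶠ x in 𝓝 0, LC (rhoC Φ) j f (parC Φ x) = 0 := by
  have hP := continuousAt_parC hΦ
  have hfP : ∀ᶠ x in 𝓝 0, AnalyticAt ℂ f (parC Φ x) := by
    refine hP.continuousAt.eventually ?_
    rw [parC_zero h0]
    exact hf.eventually_analyticAt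
  filter_upwards [hz.eventually_nhds, hfP, hΦ.eventually_analyticAt] with x hx hfx hΦx
  have hΦ' := hΦx.differentiableAt
  set D := fderiv ℂ Φ x with hD
  set a : ℂ := 2⁻¹ * (Complex.I - D (0, 0, 1)) with ha
  set b : ℂ := 2⁻¹ * D (0, Pi.single j 1, 0) with hb
  have hxx : ((parC Φ x).1.1, (parC Φ x).2.1, (2⁻¹ : ℂ) * ((parC Φ x).1.2 + (parC Φ x).2.2)) = x := by
    obtain ⟨z, χ, s⟩ := x
    simp only [parC]
    refine Prod.ext rfl (Prod.ext rfl ?_)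
    simp only
    ring
  have hΦ2 : DifferentiableAt ℂ Φ ((parC Φ x).1.1, (parC Φ x).2.1, (2⁻¹ : ℂ) * ((parC Φ x).1.2 + (parC Φ x).2.2)) := by
    rw [hxx]; exact hΦ'
  have e1 : fderiv ℂ (rhoC Φ) (parC Φ x) (0, (0, 1)) = a := by
    rw [hasFDerivAt_rhoC hΦ2, hxx]
    have : ((0 : Fin k → ℂ), (0 : Fin k → ℂ), (2⁻¹ : ℂ) * (0 + 1)) = (2⁻¹ : ℂ) • (0, 0, 1) := by
      ext <;> simp
    simp only [Prod.fst_zero, Prod.snd_zero]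
    rw [this, map_smul, ha, smul_eq_mul]
    ring
  have e2 : fderiv ℂ (rhoC Φ) (parC Φ x) (0, (Pi.single j 1, 0)) = -(2 * b) := by
    rw [hasFDerivAt_rhoC hΦ2, hxx]
    simp only [Prod.fst_zero, Prod.snd_zero, add_zero, mul_zero, sub_zero]
    rw [hb]; ring
  have hcomp : HasFDerivAt (fun y => f (parC Φ y)) ((fderiv ℂ f (parC Φ x)).comp (fderiv ℂ (parC Φ) x)) x := by
    refine HasFDerivAt.comp x hfx.differentiableAt.hasFDerivAt ?_
    have : DifferentiableAt ℂ (parC Φ) x := by unfold parC; fun_prop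
    exact this.hasFDerivAt
  have hz0 : (fderiv ℂ f (parC Φ x)).comp (fderiv ℂ (parC Φ) x) = 0 := by
    rw [← hcomp.fderiv]
    have : (fun y => f (parC Φ y)) =ᶠ[𝓝 x] fun _ => (0:ℂ) := hx
    rw [this.fderiv_eq]; simp
  have hPd : ∀ v : (Fin k → ℂ) × (Fin k → ℂ) × ℂ, fderiv ℂ (parC Φ) x v =
      ((v.1, v.2.2 + Complex.I * D v), (v.2.1, v.2.2 - Complex.I * D v)) := by
    intro v
    have hi : HasFDerivAt (fun x : (Fin k → ℂ) × (Fin k → ℂ) × ℂ => x) (ContinuousLinearMap.id ℂ _) x := hasFDerivAt_id x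
    have hs : HasFDerivAt (fun x : (Fin k → ℂ) × (Fin k → ℂ) × ℂ => x.2.2) _ x := hi.snd.snd
    have hD' := hΦ'.hasFDerivAt.const_mul Complex.I
    have hh := (hi.fst.prodMk (hs.add hD')).prodMk (hi.snd.fst.prodMk (hs.sub hD'))
    have h2 : fderiv ℂ (parC Φ) x = _ := hh.fderiv
    rw [h2]
    rfl
  have hv := congrArg (fun T => T (0, a • Pi.single j 1, b)) hz0
  simp only [ContinuousLinearMap.comp_apply, zero_apply] at hv
  rw [hPd] at hv
  have hDv : D (0, a • Pi.single j 1, b) = a * (2 * b) + b * D (0,0,1) := by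
    have : ((0 : Fin k → ℂ), a • (Pi.single j 1 : Fin k → ℂ), b)
        = a • ((0 : Fin k → ℂ), (Pi.single j 1 : Fin k → ℂ), (0:ℂ)) + b • ((0 : Fin k → ℂ), (0 : Fin k → ℂ), (1:ℂ)) := by
      ext <;> simp
    rw [this, map_add, map_smul, map_smul, smul_eq_mul, smul_eq_mul, hb]
    ring
  have hIDv : Complex.I * D (0, a • Pi.single j 1, b) = -b := by
    rw [hDv, ha]
    linear_combination b * Complex.I_mul_I
  simp only [hIDv] at hv
  have hvec : (((0 : Fin k → ℂ), b + -b), (a • (Pi.single j 1 : Fin k → ℂ), b - -b))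
      = a • ((0 : (Fin k → ℂ) × ℂ), ((Pi.single j 1 : Fin k → ℂ), (0:ℂ)))
        + (2 * b) • ((0 : (Fin k → ℂ) × ℂ), ((0 : Fin k → ℂ), (1:ℂ))) := by
    ext <;> simp
    ring
  rw [hvec, map_add, map_smul, map_smul] at hv
  rw [LC, e1, e2, neg_smul, sub_neg_eq_add]
  exact hv

lemma LC_analyticAt {k : ℕ} {F : Type*} [NormedAddCommGroup F] [NormedSpace ℂ F] [CompleteSpace F]
    {ρ : ((Fin k → ℂ) × ℂ) × ((Fin k → ℂ) × ℂ) → ℂ} {X} (hρ : AnalyticAt ℂ ρ X) (j : Fin k)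
    {f : ((Fin k → ℂ) × ℂ) × ((Fin k → ℂ) × ℂ) → F} (hf : AnalyticAt ℂ f X) :
    AnalyticAt ℂ (LC ρ j f) X := by
  unfold LC
  refine AnalyticAt.fun_sub (AnalyticAt.fun_smul ?_ ?_) (AnalyticAt.fun_smul ?_ ?_) <;>
  first | exact analyticAt_fderiv_apply hρ _ | exact analyticAt_fderiv_apply hf _

lemma foldr_LC_analyticAt {k : ℕ} {F : Type*} [NormedAddCommGroup F] [NormedSpace ℂ F] [CompleteSpace F]
    {ρ : ((Fin k → ℂ) × ℂ) × ((Fin k → ℂ) × ℂ) → ℂ} {X} (hρ : AnalyticAt ℂ ρ X)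
    {f : ((Fin k → ℂ) × ℂ) × ((Fin k → ℂ) × ℂ) → F} (hf : AnalyticAt ℂ f X) (ℓ : List (Fin k)) :
    AnalyticAt ℂ (ℓ.foldr (LC ρ) f) X := by
  induction ℓ with
  | nil => exact hf
  | cons j ℓ ih => exact LC_analyticAt hρ j ih

lemma foldr_LC_tangent {k : ℕ} {Φ : (Fin k → ℂ) × (Fin k → ℂ) × ℂ → ℂ}
    (hΦ : AnalyticAt ℂ Φ 0) (h0 : Φ 0 = 0)
    {f : ((Fin k → ℂ) × ℂ) × ((Fin k → ℂ) × ℂ) → ℂ} (hf : AnalyticAt ℂ f 0)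
    (hz : ∀ᶠ x in 𝓝 0, f (parC Φ x) = 0) (ℓ : List (Fin k)) :
    ∀ᶠ x in 𝓝 0, (ℓ.foldr (LC (rhoC Φ)) f) (parC Φ x) = 0 := by
  have hρ : AnalyticAt ℂ (rhoC Φ) 0 := analyticAt_rhoC (by simpa [← Prod.zero_eq_mk] using hΦ)
  induction ℓ with
  | nil => exact hz
  | cons j ℓ ih => exact LC_tangent hΦ h0 j (foldr_LC_analyticAt hρ hf ℓ) ih

lemma foldr_LC_complexify {k : ℕ} {F : Type*} [NormedAddCommGroup F] [NormedSpace ℂ F] [CompleteSpace F]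
    {φ : (Fin k → ℂ) × ℝ → ℝ}
    {ρ : ((Fin k → ℂ) × ℂ) × ((Fin k → ℂ) × ℂ) → ℂ} (hρ : AnalyticAt ℂ ρ 0)
    (hφ : ∀ᶠ Z in 𝓝 (0 : (Fin k → ℂ) × ℂ), rhoCN φ Z = ρ (Z, star Z))
    {f : (Fin k → ℂ) × ℂ → F}
    {g : ((Fin k → ℂ) × ℂ) × ((Fin k → ℂ) × ℂ) → F} (hg : AnalyticAt ℂ g 0)
    (hfg : ∀ᶠ Z in 𝓝 (0 : (Fin k → ℂ) × ℂ), f Z = g (Z, star Z)) (ℓ : List (Fin k)) :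
    ∀ᶠ Z in 𝓝 (0 : (Fin k → ℂ) × ℂ), (ℓ.foldr (LopN φ) f) Z = (ℓ.foldr (LC ρ) g) (Z, star Z) := by
  have hc : Tendsto (fun Z : (Fin k → ℂ) × ℂ => (Z, star Z)) (𝓝 0) (𝓝 0) := by
    have : Continuous (fun Z : (Fin k → ℂ) × ℂ => (Z, star Z)) := by fun_prop
    exact this.tendsto' _ _ (by simp)
  induction ℓ with
  | nil => exact hfg
  | cons j ℓ ih =>
    have hgl := foldr_LC_analyticAt hρ hg ℓ
    filter_upwards [ih.eventually_nhds, hφ.eventually_nhds, hc.eventually hgl.eventually_analyticAt,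
      hc.eventually hρ.eventually_analyticAt] with Z h1 h2 h3 h4
    simp only [List.foldr_cons, LopN, LC]
    rw [(wirtinger_of_complexify h3.differentiableAt h1 _).1,
      (wirtinger_of_complexify h3.differentiableAt h1 _).1,
      (wirtinger_of_complexify h4.differentiableAt h2 _).1,
      (wirtinger_of_complexify h4.differentiableAt h2 _).1]
    have s1 : star ((0 : Fin k → ℂ), (1 : ℂ)) = (0, 1) := by ext <;> simp
    have s2 : star ((Pi.single j 1 : Fin k → ℂ), (0 : ℂ)) = (Pi.single j 1, 0) := by
      ext i
      · simp only [Prod.fst_star, Pi.star_apply, Pi.single_apply]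
        split_ifs <;> simp
      · simp
    rw [s1, s2]

lemma foldr_LC_split {k m : ℕ}
    {ρ : ((Fin k → ℂ) × ℂ) × ((Fin k → ℂ) × ℂ) → ℂ} (hρ : AnalyticAt ℂ ρ 0)
    {α : (Fin k → ℂ) × ℂ → Fin m → ℂ} (hα : AnalyticAt ℂ α 0)
    {R : ((Fin k → ℂ) × ℂ) × ((Fin k → ℂ) × ℂ) → Fin m → ℂ} (hR : AnalyticAt ℂ R 0)
    {B : ((Fin k → ℂ) × ℂ) × ((Fin k → ℂ) × ℂ) → ℂ} (hB : AnalyticAt ℂ B 0) (ℓ : List (Fin k)) :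
    ∀ᶠ X in 𝓝 0, (ℓ.foldr (LC ρ) (fun X => ∑ j, α X.1 j * R X j + B X)) X
      = ∑ j, α X.1 j * (ℓ.foldr (LC ρ) R) X j + (ℓ.foldr (LC ρ) B) X := by
  have hα' : ∀ᶠ X : ((Fin k → ℂ) × ℂ) × ((Fin k → ℂ) × ℂ) in 𝓝 0, AnalyticAt ℂ α X.1 :=
    (continuous_fst.tendsto' (0 : ((Fin k → ℂ) × ℂ) × ((Fin k → ℂ) × ℂ)) 0 rfl).eventually
      hα.eventually_analyticAt
  induction ℓ with
  | nil => exact Eventually.of_forall fun X => rfl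
  | cons i ℓ ih =>
    have hRl := foldr_LC_analyticAt hρ hR ℓ
    have hBl := foldr_LC_analyticAt hρ hB ℓ
    filter_upwards [ih.eventually_nhds, hα', hRl.eventually_analyticAt, hBl.eventually_analyticAt]
      with X h1 h2 h3 h4
    simp only [List.foldr_cons]
    set Rl := ℓ.foldr (LC ρ) R
    set Bl := ℓ.foldr (LC ρ) B
    have key : ∀ v : (Fin k → ℂ) × ℂ,
        fderiv ℂ (ℓ.foldr (LC ρ) (fun X => ∑ j, α X.1 j * R X j + B X)) X (0, v)
        = ∑ j, α X.1 j * (fderiv ℂ Rl X (0, v)) j + fderiv ℂ Bl X (0, v) := by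
      intro v
      rw [Filter.EventuallyEq.fderiv_eq h1]
      have ha : ∀ j, HasFDerivAt (fun X : ((Fin k → ℂ) × ℂ) × ((Fin k → ℂ) × ℂ) => α X.1 j)
          ((ContinuousLinearMap.proj j).comp ((fderiv ℂ α X.1).comp (ContinuousLinearMap.fst ℂ _ _))) X := by
        intro j
        have hh : HasFDerivAt (fun X : ((Fin k → ℂ) × ℂ) × ((Fin k → ℂ) × ℂ) => α X.1)
            ((fderiv ℂ α X.1).comp (ContinuousLinearMap.fst ℂ _ _)) X :=
          HasFDerivAt.comp X h2.differentiableAt.hasFDerivAt hasFDerivAt_fst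
        exact hasFDerivAt_pi'.mp hh j
      have hr : ∀ j, HasFDerivAt (fun X => Rl X j)
          ((ContinuousLinearMap.proj j).comp (fderiv ℂ Rl X)) X :=
        fun j => hasFDerivAt_pi'.mp h3.differentiableAt.hasFDerivAt j
      have hs := (HasFDerivAt.fun_sum (u := Finset.univ) (fun j _ => (ha j).mul (hr j))).add
        h4.differentiableAt.hasFDerivAt
      have hs' : fderiv ℂ (fun X => ∑ j, α X.1 j * Rl X j + Bl X) X = _ := hs.fderiv
      rw [hs']
      simp
    rw [LC, key, key]
    simp only [LC, smul_eq_mul, Pi.sub_apply, Pi.smul_apply]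
    rw [mul_add, mul_add, Finset.mul_sum, Finset.mul_sum]
    have : ∀ j, α X.1 j * (fderiv ℂ ρ X (0, (0, 1)) * fderiv ℂ Rl X (0, (Pi.single i 1, 0)) j
        - fderiv ℂ ρ X (0, (Pi.single i 1, 0)) * fderiv ℂ Rl X (0, (0, 1)) j)
        = fderiv ℂ ρ X (0, (0, 1)) * (α X.1 j * fderiv ℂ Rl X (0, (Pi.single i 1, 0)) j)
        - fderiv ℂ ρ X (0, (Pi.single i 1, 0)) * (α X.1 j * fderiv ℂ Rl X (0, (0, 1)) j) := by
      intro j; ring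
    simp only [this, Finset.sum_sub_distrib]
    ring

lemma foldr_LC_isBigO {k : ℕ} {F : Type*} [NormedAddCommGroup F] [NormedSpace ℂ F] [CompleteSpace F]
    {ρ : ((Fin k → ℂ) × ℂ) × ((Fin k → ℂ) × ℂ) → ℂ} {X₀} (hρ : AnalyticAt ℂ ρ X₀)
    {f : ((Fin k → ℂ) × ℂ) × ((Fin k → ℂ) × ℂ) → F} (hf : AnalyticAt ℂ f X₀) (ℓ : List (Fin k)) :
    ∀ p : ℕ, (f =O[𝓝 X₀] fun X => ‖X - X₀‖ ^ (p + ℓ.length)) →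
      (ℓ.foldr (LC ρ) f) =O[𝓝 X₀] fun X => ‖X - X₀‖ ^ p := by
  induction ℓ with
  | nil => intro p h; simpa using h
  | cons j ℓ ih =>
    intro p h
    have h1 := ih (p + 1) (by simpa [add_assoc, add_comm, add_left_comm] using h)
    have hfl := foldr_LC_analyticAt hρ hf ℓ
    have hc : ∀ v, (fun X => fderiv ℂ ρ X v) =O[𝓝 X₀] fun _ => (1 : ℝ) := fun v =>
      (analyticAt_fderiv_apply hρ v).continuousAt.isBigO_one ℝ
    have hd : ∀ v, (fun X => fderiv ℂ (ℓ.foldr (LC ρ) f) X v) =O[𝓝 X₀] fun X => ‖X - X₀‖ ^ p :=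
      fun v => isBigO_fderiv hfl h1 v
    have h2 := ((hc (0, (0, 1))).smul (hd (0, (Pi.single j 1, 0)))).sub
      ((hc (0, (Pi.single j 1, 0))).smul (hd (0, (0, 1))))
    simp only [one_smul] at h2
    exact h2

end Operators


section Segre

lemma span_bound {T ι : Type*} [TopologicalSpace T] {x₀ : T} [Fintype ι] {m : ℕ}
    (v : ι → T → Fin m → ℂ) (hc : ∀ i, ContinuousAt (v i) x₀)
    (hs : Submodule.span ℂ (Set.range fun i => v i x₀) = ⊤) :
    ∃ C : ℝ, ∀ᶠ x in 𝓝 x₀, ∀ a : Fin m → ℂ, ‖a‖ ≤ C * ∑ i, ‖∑ j, a j * v i x j‖ := by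
  have h1 : ∀ j : Fin m, ∃ c : ι → ℂ, ∑ i, c i • v i x₀ = Pi.single j (1 : ℂ) := by
    intro j
    rw [← Submodule.mem_span_range_iff_exists_fun, hs]
    trivial
  choose c hcc using h1
  set K : ℝ := ∑ j, ∑ i, ‖c j i‖ with hK
  have hKle : ∀ j i, ‖c j i‖ ≤ K := by
    intro j i
    refine (Finset.single_le_sum (f := fun i => ‖c j i‖) (fun i _ => norm_nonneg _) (Finset.mem_univ i)).trans ?_
    exact Finset.single_le_sum (f := fun j => ∑ i, ‖c j i‖)
      (fun j _ => Finset.sum_nonneg fun i _ => norm_nonneg _) (Finset.mem_univ j)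
  have hK0 : 0 ≤ K := Finset.sum_nonneg fun j _ => Finset.sum_nonneg fun i _ => norm_nonneg _
  have hw : ∀ j : Fin m, ContinuousAt (fun x => ∑ i, c j i • v i x) x₀ := by
    intro j
    exact tendsto_finsetSum _ fun i _ => (hc i).const_smul (c j i)
  have hm : (0 : ℝ) < 1 / (2 * (m + 1)) := by positivity
  have hev : ∀ᶠ x in 𝓝 x₀, ∀ j : Fin m, ‖(∑ i, c j i • v i x) - Pi.single j (1 : ℂ)‖ < 1 / (2 * (m + 1)) := by
    refine eventually_all.mpr fun j => ?_
    have h2 : ∀ᶠ x in 𝓝 x₀, dist (∑ i, c j i • v i x) (∑ i, c j i • v i x₀) < 1 / (2 * ((m : ℝ) + 1)) :=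
      Metric.tendsto_nhds.mp (hw j) _ hm
    filter_upwards [h2] with x h3
    rwa [hcc j, dist_eq_norm] at h3
  refine ⟨2 * K, ?_⟩
  filter_upwards [hev] with x hx a
  set S := ∑ i, ‖∑ j, a j * v i x j‖ with hS
  have hS0 : 0 ≤ S := Finset.sum_nonneg fun i _ => norm_nonneg _
  have hb : ‖a‖ ≤ K * S + ‖a‖ / 2 := by
    refine (pi_norm_le_iff_of_nonneg (by positivity)).mpr fun j => ?_
    set w := ∑ i, c j i • v i x with hwdef
    have e1 : ∑ l, a l * w l = ∑ i, c j i * ∑ l, a l * v i x l := by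
      simp only [hwdef, Finset.sum_apply, Pi.smul_apply, smul_eq_mul, Finset.mul_sum]
      rw [Finset.sum_comm]
      refine Finset.sum_congr rfl fun i _ => Finset.sum_congr rfl fun l _ => by ring
    have e2 : a j = ∑ l, a l * w l - ∑ l, a l * (w - (Pi.single j (1 : ℂ) : Fin m → ℂ)) l := by
      rw [← Finset.sum_sub_distrib]
      have : ∀ l, a l * w l - a l * (w - (Pi.single j (1 : ℂ) : Fin m → ℂ)) l = if l = j then a l else 0 := by
        intro l
        simp only [Pi.sub_apply, Pi.single_apply]
        split_ifs <;> ring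
      rw [Finset.sum_congr rfl fun l _ => this l]
      simp
    have b1 : ‖∑ l, a l * w l‖ ≤ K * S := by
      rw [e1, hS, Finset.mul_sum]
      refine (norm_sum_le _ _).trans (Finset.sum_le_sum fun i _ => ?_)
      rw [norm_mul]
      gcongr
      exact hKle j i
    have b2 : ‖∑ l, a l * (w - (Pi.single j (1 : ℂ) : Fin m → ℂ)) l‖ ≤ ‖a‖ / 2 := by
      calc ‖∑ l, a l * (w - (Pi.single j (1 : ℂ) : Fin m → ℂ)) l‖
          ≤ ∑ l : Fin m, ‖a‖ * (1 / (2 * (m + 1))) := by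
            refine (norm_sum_le _ _).trans (Finset.sum_le_sum fun l _ => ?_)
            rw [norm_mul]
            gcongr
            · exact norm_le_pi_norm a l
            · exact (norm_le_pi_norm _ l).trans (hx j).le
        _ = ‖a‖ * (m / (2 * (m + 1))) := by
            simp only [Finset.sum_const, Finset.card_univ, Fintype.card_fin, nsmul_eq_mul]
            field_simp
        _ ≤ ‖a‖ * (1 / 2) := by
            refine mul_le_mul_of_nonneg_left ?_ (norm_nonneg _)
            rw [div_le_div_iff₀ (by positivity) (by positivity)]
            linarith
        _ = ‖a‖ / 2 := by ring
    rw [e2]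
    exact (norm_sub_le _ _).trans (add_le_add b1 b2)
  linarith

lemma pow_weaken {V : Type*} [NormedAddCommGroup V] (x₀ : V) {p q : ℕ} (h : p ≤ q) :
    (fun x : V => ‖x - x₀‖ ^ q) =O[𝓝 x₀] fun x => ‖x - x₀‖ ^ p := by
  refine Asymptotics.IsBigO.of_bound 1 ?_
  have : ∀ᶠ x in 𝓝 x₀, ‖x - x₀‖ < 1 := by
    filter_upwards [Metric.ball_mem_nhds x₀ one_pos] with x hx
    simpa [dist_eq_norm] using hx
  filter_upwards [this] with x hx
  rw [norm_pow, norm_pow, norm_norm, one_mul]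
  exact pow_le_pow_of_le_one (norm_nonneg _) hx.le h

lemma segre_step {k m κ : ℕ} {Φ : (Fin k → ℂ) × (Fin k → ℂ) × ℂ → ℂ}
    (hΦ : AnalyticAt ℂ Φ 0) (h0 : Φ 0 = 0)
    {R R2 : ((Fin k → ℂ) × ℂ) × ((Fin k → ℂ) × ℂ) → Fin m → ℂ} (hR : AnalyticAt ℂ R 0)
    (hR2 : AnalyticAt ℂ R2 0)
    {α : (Fin k → ℂ) × ℂ → Fin m → ℂ} (hα : AnalyticAt ℂ α 0)
    (hzero : ∀ᶠ x in 𝓝 0, ∑ j, α (parC Φ x).1 j * R (parC Φ x) j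
      + ∑ j, star (α (star (parC Φ x).2)) j * R2 (parC Φ x) j = 0)
    (hspan : Submodule.span ℂ {v : Fin m → ℂ | ∃ ℓ : List (Fin k), ℓ.length ≤ κ ∧
        (ℓ.foldr (LC (rhoC Φ)) R) 0 = v} = ⊤)
    {T : ((Fin k → ℂ) × ℂ) × (Fin k → ℂ) → ℂ} {K : NNReal} {s : Set (((Fin k → ℂ) × ℂ) × (Fin k → ℂ))}
    (hs : s ∈ 𝓝 0) (hT : LipschitzOnWith K T s)
    (hTρ : ∀ᶠ X in 𝓝 0, rhoC Φ X = 0 ↔ T (X.1, X.2.1) = X.2.2) :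
    ∀ᶠ X₀ : ((Fin k → ℂ) × ℂ) × ((Fin k → ℂ) × ℂ) in 𝓝 0, rhoC Φ X₀ = 0 → ∀ q : ℕ,
      (α =O[𝓝 (star X₀.2)] fun Z => ‖Z - star X₀.2‖ ^ (q + κ)) →
      α =O[𝓝 X₀.1] fun Z => ‖Z - X₀.1‖ ^ q := by
  have hρ : AnalyticAt ℂ (rhoC Φ) 0 := analyticAt_rhoC (by simpa [← Prod.zero_eq_mk] using hΦ)
  set B : ((Fin k → ℂ) × ℂ) × ((Fin k → ℂ) × ℂ) → ℂ :=
    fun X => ∑ j, star (α (star X.2)) j * R2 X j with hB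
  have hfst : AnalyticAt ℂ (fun X : ((Fin k → ℂ) × ℂ) × ((Fin k → ℂ) × ℂ) => X.1) 0 :=
    analyticAt_of_linear _ (by intro X Y; simp) (by intro c X; simp) _
  have hsnd : AnalyticAt ℂ (fun X : ((Fin k → ℂ) × ℂ) × ((Fin k → ℂ) × ℂ) => X.2) 0 :=
    analyticAt_of_linear _ (by intro X Y; simp) (by intro c X; simp) _
  have hαs : AnalyticAt ℂ (fun X : ((Fin k → ℂ) × ℂ) × ((Fin k → ℂ) × ℂ) => star (α (star X.2))) 0 :=
    AnalyticAt.fun_comp (g := fun Z => star (α (star Z))) (f := fun X : ((Fin k → ℂ) × ℂ) × ((Fin k → ℂ) × ℂ) => X.2)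
      (analyticAt_star_star hα) hsnd
  have hBa : AnalyticAt ℂ B 0 := by
    refine Finset.analyticAt_fun_sum _ fun j _ => ?_
    exact (analyticAt_pi_iff.mp hαs j).fun_mul (analyticAt_pi_iff.mp hR2 j)
  have hαf : AnalyticAt ℂ (fun X : ((Fin k → ℂ) × ℂ) × ((Fin k → ℂ) × ℂ) => α X.1) 0 :=
    AnalyticAt.fun_comp (g := α) (f := fun X : ((Fin k → ℂ) × ℂ) × ((Fin k → ℂ) × ℂ) => X.1) hα hfst
  have hA : AnalyticAt ℂ (fun X => ∑ j, α X.1 j * R X j + B X) 0 := by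
    refine AnalyticAt.fun_add (Finset.analyticAt_fun_sum _ fun j _ => ?_) hBa
    exact (analyticAt_pi_iff.mp hαf j).fun_mul (analyticAt_pi_iff.mp hR j)
  have hπ : Tendsto (fun X : ((Fin k → ℂ) × ℂ) × ((Fin k → ℂ) × ℂ) =>
      (X.1.1, X.2.1, (2⁻¹ : ℂ) * (X.1.2 + X.2.2))) (𝓝 0) (𝓝 0) := by
    have : Continuous (fun X : ((Fin k → ℂ) × ℂ) × ((Fin k → ℂ) × ℂ) =>
      (X.1.1, X.2.1, (2⁻¹ : ℂ) * (X.1.2 + X.2.2))) := by fun_prop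
    exact this.tendsto' _ _ (by simp)
  let ι := {ℓ : List (Fin k) // ℓ.length ≤ κ}
  have hfin : Finite ι := (List.finite_length_le (Fin k) κ).to_subtype
  have : Fintype ι := Fintype.ofFinite ι
  have hid : ∀ᶠ X in 𝓝 0, ∀ ℓ : ι, rhoC Φ X = 0 →
      ∑ j, α X.1 j * (ℓ.1.foldr (LC (rhoC Φ)) R) X j = - (ℓ.1.foldr (LC (rhoC Φ)) B) X := by
    refine eventually_all.mpr fun ℓ => ?_
    filter_upwards [foldr_LC_split hρ hα hR hBa ℓ.1,
      hπ.eventually (foldr_LC_tangent hΦ h0 hA hzero ℓ.1)] with X h1 h2 h3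
    rw [parC_of_rhoC Φ X h3, h1] at h2
    exact eq_neg_of_add_eq_zero_left h2
  obtain ⟨C, hC⟩ := span_bound (x₀ := (0 : ((Fin k → ℂ) × ℂ) × ((Fin k → ℂ) × ℂ)))
    (fun ℓ : ι => ℓ.1.foldr (LC (rhoC Φ)) R)
    (fun ℓ => (foldr_LC_analyticAt hρ hR ℓ.1).continuousAt) (by
      rw [← hspan]
      congr 1
      ext v
      simp [ι, Set.mem_range])
  have hQ : ∀ᶠ X in 𝓝 0, rhoC Φ X = 0 → ‖α X.1‖ ≤ C * ∑ ℓ : ι, ‖(ℓ.1.foldr (LC (rhoC Φ)) B) X‖ := by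
    filter_upwards [hid, hC] with X h1 h2 h3
    refine (h2 (α X.1)).trans (le_of_eq ?_)
    congr 1
    refine Finset.sum_congr rfl fun ℓ _ => ?_
    rw [h1 ℓ h3, norm_neg]
  have hproj : Tendsto (fun X : ((Fin k → ℂ) × ℂ) × ((Fin k → ℂ) × ℂ) => (X.1, X.2.1)) (𝓝 0) (𝓝 0) := by
    have : Continuous (fun X : ((Fin k → ℂ) × ℂ) × ((Fin k → ℂ) × ℂ) => (X.1, X.2.1)) := by fun_prop
    exact this.tendsto' _ _ (by simp)
  filter_upwards [hQ.eventually_nhds, hρ.eventually_analyticAt, hBa.eventually_analyticAt,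
    hR2.eventually_analyticAt, hTρ.eventually_nhds, hproj.eventually (eventually_eventually_nhds.mpr hs)]
    with X₀ hQ₀ hρ₀ hB₀ hR2₀ hT₀ hs₀ hX₀ q hα₀
  have hTX : T (X₀.1, X₀.2.1) = X₀.2.2 := hT₀.self_of_nhds.mp hX₀
  have hs₀' : s ∈ 𝓝 (X₀.1, X₀.2.1) := hs₀
  have hTc : ContinuousAt T (X₀.1, X₀.2.1) := hT.continuousOn.continuousAt hs₀'
  have hin : Tendsto (fun Z : (Fin k → ℂ) × ℂ => (Z, X₀.2.1)) (𝓝 X₀.1) (𝓝 (X₀.1, X₀.2.1)) := by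
    have : Continuous (fun Z : (Fin k → ℂ) × ℂ => (Z, X₀.2.1)) := by fun_prop
    exact this.tendsto _
  set XX : (Fin k → ℂ) × ℂ → ((Fin k → ℂ) × ℂ) × ((Fin k → ℂ) × ℂ) :=
    fun Z => (Z, (X₀.2.1, T (Z, X₀.2.1))) with hXX
  have hXt : Tendsto XX (𝓝 X₀.1) (𝓝 X₀) := by
    have h1 : Tendsto (fun Z => T (Z, X₀.2.1)) (𝓝 X₀.1) (𝓝 X₀.2.2) := by
      rw [← hTX]; exact hTc.tendsto.comp hin
    exact (tendsto_id.prodMk_nhds (tendsto_const_nhds.prodMk_nhds h1))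
  have hXO : (fun Z => XX Z - X₀) =O[𝓝 X₀.1] fun Z => Z - X₀.1 := by
    refine Asymptotics.IsBigO.of_bound (K + 1) ?_
    filter_upwards [hin.eventually hs₀'] with Z hZ
    have hl := hT.norm_sub_le hZ (mem_of_mem_nhds hs₀')
    have hn : ‖(Z, X₀.2.1) - (X₀.1, X₀.2.1)‖ = ‖Z - X₀.1‖ := by
      simp [Prod.norm_def]
    rw [hn, hTX] at hl
    have hK : (0:ℝ) ≤ K := K.2
    have hZn := norm_nonneg (Z - X₀.1)
    simp only [hXX, Prod.norm_def, Prod.fst_sub, Prod.snd_sub, sub_self, norm_zero] at hl hZn ⊢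
    refine max_le (by nlinarith) (max_le (by positivity) (by nlinarith))
  -- vanishing order of `B`
  have hBO : B =O[𝓝 X₀] fun X => ‖X - X₀‖ ^ (q + κ) := by
    have ht : Tendsto (fun X : ((Fin k → ℂ) × ℂ) × ((Fin k → ℂ) × ℂ) => star X.2) (𝓝 X₀) (𝓝 (star X₀.2)) := by
      have : Continuous (fun X : ((Fin k → ℂ) × ℂ) × ((Fin k → ℂ) × ℂ) => star X.2) := by fun_prop
      exact this.tendsto _
    have h1 := hα₀.comp_tendsto ht
    have h2 : (fun X : ((Fin k → ℂ) × ℂ) × ((Fin k → ℂ) × ℂ) => α (star X.2)) =O[𝓝 X₀] fun X => ‖X - X₀‖ ^ (q + κ) := by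
      refine h1.trans (Asymptotics.IsBigO.of_bound 1 (Eventually.of_forall fun X => ?_))
      simp only [Function.comp_apply, norm_pow, norm_norm, one_mul]
      gcongr
      rw [← star_sub, norm_star]
      exact norm_snd_le (X - X₀)
    refine Asymptotics.IsBigO.fun_sum fun j _ => ?_
    have h3 : (fun X : ((Fin k → ℂ) × ℂ) × ((Fin k → ℂ) × ℂ) => star (α (star X.2)) j) =O[𝓝 X₀] fun X => ‖X - X₀‖ ^ (q + κ) := by
      refine (Asymptotics.IsBigO.of_bound 1 (Eventually.of_forall fun X => ?_)).trans h2
      rw [one_mul, Pi.star_apply, norm_star]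
      exact norm_le_pi_norm _ j
    have h4 : (fun X => R2 X j) =O[𝓝 X₀] fun _ => (1 : ℝ) :=
      (analyticAt_pi_iff.mp hR2₀ j).continuousAt.isBigO_one ℝ
    simpa using h3.mul h4
  have hBl : ∀ ℓ : ι, (fun Z => (ℓ.1.foldr (LC (rhoC Φ)) B) (XX Z)) =O[𝓝 X₀.1] fun Z => ‖Z - X₀.1‖ ^ q := by
    intro ℓ
    have h1 := foldr_LC_isBigO hρ₀ hB₀ ℓ.1 q (hBO.trans (pow_weaken X₀ (Nat.add_le_add_left ℓ.2 q)))
    have h2 := h1.comp_tendsto hXt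
    refine h2.trans ?_
    exact (hXO.norm_left.norm_right).pow q
  have hsum : (fun Z => C * ∑ ℓ : ι, ‖(ℓ.1.foldr (LC (rhoC Φ)) B) (XX Z)‖) =O[𝓝 X₀.1] fun Z => ‖Z - X₀.1‖ ^ q :=
    (Asymptotics.IsBigO.fun_sum fun ℓ _ => (hBl ℓ).norm_left).const_mul_left C
  refine Asymptotics.IsBigO.trans (Asymptotics.IsBigO.of_bound 1 ?_) hsum
  filter_upwards [hXt.eventually hQ₀, hXt.eventually hT₀] with Z h1 h2
  rw [one_mul]
  exact (h1 (h2.mpr rfl)).trans (le_abs_self _)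

end Segre

section PhiFacts

/-- The embedding of `ℂᵏ × ℝ` onto the real points of the complexification. -/
noncomputable def iotaL (k : ℕ) : ((Fin k → ℂ) × ℝ) →L[ℝ] ((Fin k → ℂ) × (Fin k → ℂ) × ℂ) :=
  LinearMap.toContinuousLinearMap
    { toFun := fun p => (p.1, star p.1, (p.2 : ℂ))
      map_add' := by intro p q; simp
      map_smul' := by
        intro c p
        refine Prod.ext rfl (Prod.ext ?_ ?_)
        · ext i; simp
        · simp }

lemma iotaL_apply {k : ℕ} (p : (Fin k → ℂ) × ℝ) : iotaL k p = (p.1, star p.1, (p.2 : ℂ)) := rfl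

lemma fderiv_iota {k : ℕ} {f : (Fin k → ℂ) × ℝ → ℂ} {g : (Fin k → ℂ) × (Fin k → ℂ) × ℂ → ℂ}
    {p : (Fin k → ℂ) × ℝ} (hg : DifferentiableAt ℂ g (iotaL k p))
    (h : ∀ᶠ q in 𝓝 p, f q = g (iotaL k q)) (v : (Fin k → ℂ) × ℝ) :
    fderiv ℝ f p v = fderiv ℂ g (iotaL k p) (iotaL k v) := by
  have h1 : HasFDerivAt (fun q => g (iotaL k q))
      (((fderiv ℂ g (iotaL k p)).restrictScalars ℝ).comp (iotaL k)) p :=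
    HasFDerivAt.comp p (hg.hasFDerivAt.restrictScalars ℝ) (iotaL k).hasFDerivAt
  have h2 : HasFDerivAt f _ p := h1.congr_of_eventuallyEq h
  rw [h2.fderiv]
  rfl

lemma wPhi_iota {k : ℕ} {f : (Fin k → ℂ) × ℝ → ℂ} {g : (Fin k → ℂ) × (Fin k → ℂ) × ℂ → ℂ}
    {p : (Fin k → ℂ) × ℝ} (hg : DifferentiableAt ℂ g (iotaL k p))
    (h : ∀ᶠ q in 𝓝 p, f q = g (iotaL k q)) (j : Fin k) :
    wPhiDBar j f p = fderiv ℂ g (iotaL k p) (0, Pi.single j 1, 0) ∧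
    wPhiD j f p = fderiv ℂ g (iotaL k p) (Pi.single j 1, 0, 0) := by
  unfold wPhiDBar wPhiD
  rw [fderiv_iota hg h, fderiv_iota hg h]
  set D := fderiv ℂ g (iotaL k p)
  have e1 : iotaL k (Pi.single j 1, 0) = ((Pi.single j 1 : Fin k → ℂ), (0 : Fin k → ℂ), (0:ℂ))
      + ((0 : Fin k → ℂ), (Pi.single j 1 : Fin k → ℂ), (0:ℂ)) := by
    rw [iotaL_apply]
    refine Prod.ext (by simp) (Prod.ext ?_ (by simp))
    ext i
    by_cases hi : i = j
    · subst hi; simp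
    · simp [hi]
  have e2 : iotaL k (Pi.single j I, 0) = I • ((Pi.single j 1 : Fin k → ℂ), (0 : Fin k → ℂ), (0:ℂ))
      - I • ((0 : Fin k → ℂ), (Pi.single j 1 : Fin k → ℂ), (0:ℂ)) := by
    rw [iotaL_apply]
    refine Prod.ext ?_ (Prod.ext ?_ (by simp))
    · ext i
      by_cases hi : i = j
      · subst hi; simp
      · simp [hi]
    · ext i
      by_cases hi : i = j
      · subst hi; simp
      · simp [hi]
  rw [e1, e2, map_add, map_sub, map_smul, map_smul]
  simp only [smul_eq_mul]
  constructor
  · linear_combination (2⁻¹ * (D (Pi.single j 1, 0, 0)) - 2⁻¹ * D (0, Pi.single j 1, 0)) * I_mul_I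
  · linear_combination (-2⁻¹ * (D (Pi.single j 1, 0, 0)) + 2⁻¹ * D (0, Pi.single j 1, 0)) * I_mul_I

lemma exists_Phi {k : ℕ} {φ : (Fin k → ℂ) × ℝ → ℝ} (hφa : AnalyticAt ℝ φ 0) :
    ∃ Φ : (Fin k → ℂ) × (Fin k → ℂ) × ℂ → ℂ, AnalyticAt ℂ Φ 0 ∧
      ∀ᶠ p in 𝓝 (0 : (Fin k → ℂ) × ℝ), ((φ p : ℝ) : ℂ) = Φ (iotaL k p) := by
  have hf : AnalyticAt ℝ (fun Z : (Fin k → ℂ) × ℂ => ((φ (Z.1, Z.2.re) : ℝ) : ℂ)) 0 := by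
    have h1 : AnalyticAt ℝ (fun Z : (Fin k → ℂ) × ℂ => (Z.1, Z.2.re)) 0 :=
      ((ContinuousLinearMap.fst ℝ (Fin k → ℂ) ℂ).prod
        (Complex.reCLM.comp (ContinuousLinearMap.snd ℝ (Fin k → ℂ) ℂ))).analyticAt 0
    have h2 : AnalyticAt ℝ (fun Z : (Fin k → ℂ) × ℂ => φ (Z.1, Z.2.re)) 0 :=
      AnalyticAt.fun_comp (g := φ) (by simpa [← Prod.zero_eq_mk] using hφa) h1
    exact (Complex.ofRealCLM.analyticAt _).fun_comp h2
  obtain ⟨g, hg, hgf⟩ := exists_complexify _ hf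
  refine ⟨fun x => g ((x.1, x.2.2), (x.2.1, x.2.2)), ?_, ?_⟩
  · have h1 : AnalyticAt ℂ (fun x : (Fin k → ℂ) × (Fin k → ℂ) × ℂ => ((x.1, x.2.2), (x.2.1, x.2.2))) 0 :=
      analyticAt_of_linear _ (fun x y => rfl) (fun c x => rfl) _
    exact AnalyticAt.fun_comp (g := g) (by simpa [← Prod.zero_eq_mk] using hg) h1
  · have ht : Tendsto (fun p : (Fin k → ℂ) × ℝ => (p.1, (p.2 : ℂ))) (𝓝 0) (𝓝 0) := by
      have : Continuous (fun p : (Fin k → ℂ) × ℝ => (p.1, (p.2 : ℂ))) := by fun_prop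
      exact this.tendsto' _ _ (by simp)
    filter_upwards [ht.eventually hgf] with p hp
    simpa [iotaL_apply, Prod.star_def] using hp

lemma Phi_zero {k : ℕ} {φ : (Fin k → ℂ) × ℝ → ℝ} {Φ : (Fin k → ℂ) × (Fin k → ℂ) × ℂ → ℂ}
    (hφ0 : φ 0 = 0)
    (h : ∀ᶠ p in 𝓝 (0 : (Fin k → ℂ) × ℝ), ((φ p : ℝ) : ℂ) = Φ (iotaL k p)) : Φ 0 = 0 := by
  have := h.self_of_nhds
  rw [map_zero, hφ0] at this
  simpa using this.symm

lemma Phi_fderiv_zero {k : ℕ} {φ : (Fin k → ℂ) × ℝ → ℝ} {Φ : (Fin k → ℂ) × (Fin k → ℂ) × ℂ → ℂ}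
    (hφa : AnalyticAt ℝ φ 0) (hφ1 : fderiv ℝ φ 0 = 0) (hΦ : AnalyticAt ℂ Φ 0)
    (h : ∀ᶠ p in 𝓝 (0 : (Fin k → ℂ) × ℝ), ((φ p : ℝ) : ℂ) = Φ (iotaL k p)) :
    fderiv ℂ Φ 0 = 0 := by
  have hd : HasFDerivAt (fun p => ((φ p : ℝ) : ℂ)) (0 : ((Fin k → ℂ) × ℝ) →L[ℝ] ℂ) 0 := by
    have h1 := hφa.differentiableAt.hasFDerivAt
    rw [hφ1] at h1
    have h2 := HasFDerivAt.comp (0 : (Fin k → ℂ) × ℝ) (Complex.ofRealCLM.hasFDerivAt (x := φ 0)) h1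
    rw [ContinuousLinearMap.comp_zero] at h2
    exact h2
  have hz : ∀ v, fderiv ℂ Φ 0 (iotaL k v) = 0 := by
    intro v
    have h1 := fderiv_iota (p := 0) (by simpa using hΦ.differentiableAt) h v
    rw [hd.fderiv, map_zero] at h1
    exact h1.symm
  have h1 : ∀ v : Fin k → ℂ, fderiv ℂ Φ 0 (v, 0, 0) + fderiv ℂ Φ 0 (0, star v, 0) = 0 := by
    intro v
    have h3 := hz (v, 0)
    rw [← map_add]
    simpa [iotaL_apply] using h3
  have h2 : ∀ v : Fin k → ℂ, fderiv ℂ Φ 0 (v, 0, 0) - fderiv ℂ Φ 0 (0, star v, 0) = 0 := by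
    intro v
    have h3 := h1 (I • v)
    have e1 : ((I • v : Fin k → ℂ), (0 : Fin k → ℂ), (0:ℂ)) = I • (v, 0, 0) := by simp
    have e2 : ((0 : Fin k → ℂ), star (I • v), (0:ℂ)) = (-I) • (0, star v, 0) := by simp [star_smul]
    rw [e1, e2, map_smul, map_smul, smul_eq_mul, smul_eq_mul] at h3
    have : I * (fderiv ℂ Φ 0 (v, 0, 0) - fderiv ℂ Φ 0 (0, star v, 0)) = 0 := by linear_combination h3
    exact (mul_eq_zero.mp this).resolve_left I_ne_zero
  have a1 : ∀ v : Fin k → ℂ, fderiv ℂ Φ 0 (v, 0, 0) = 0 := fun v => by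
    linear_combination (h1 v + h2 v) / 2
  have a2 : ∀ v : Fin k → ℂ, fderiv ℂ Φ 0 (0, v, 0) = 0 := fun v => by
    have := h1 (star v)
    rwa [a1, zero_add, star_star] at this
  have a3 : fderiv ℂ Φ 0 (0, 0, 1) = 0 := by
    have := hz (0, 1)
    simpa [iotaL_apply] using this
  ext v
  · simpa [Prod.zero_eq_mk] using a1 v
  · simpa using a2 v
  · simpa using a3

lemma Phi_real {k : ℕ} {φ : (Fin k → ℂ) × ℝ → ℝ} {Φ : (Fin k → ℂ) × (Fin k → ℂ) × ℂ → ℂ}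
    (hΦ : AnalyticAt ℂ Φ 0)
    (h : ∀ᶠ p in 𝓝 (0 : (Fin k → ℂ) × ℝ), ((φ p : ℝ) : ℂ) = Φ (iotaL k p)) :
    ∀ᶠ x in 𝓝 (0 : (Fin k → ℂ) × (Fin k → ℂ) × ℂ),
      Φ x = star (Φ (star x.2.1, star x.1, star x.2.2)) := by
  have h1 : AnalyticAt ℂ (fun x : (Fin k → ℂ) × (Fin k → ℂ) × ℂ => Φ (x.2.1, x.1, x.2.2)) 0 := by
    have : AnalyticAt ℂ (fun x : (Fin k → ℂ) × (Fin k → ℂ) × ℂ => (x.2.1, x.1, x.2.2)) 0 :=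
      analyticAt_of_linear _ (by intro x y; simp) (by intro c x; simp) _
    exact AnalyticAt.fun_comp (g := Φ) (by simpa [← Prod.zero_eq_mk] using hΦ) this
  have h2 := hΦ.fun_sub (analyticAt_star_star h1)
  have h3 := eventually_zero_of_real
    (fun x : (Fin k → ℂ) × (Fin k → ℂ) × ℂ => (star x.2.1, star x.1, star x.2.2))
    (by intro x y; simp) (by intro c x; simp [star_smul])
    (by intro x; simp only [Prod.norm_def, norm_star]; rw [max_left_comm])
    (by intro x; simp) _ h2 (by
      have ht : Tendsto (fun x : (Fin k → ℂ) × (Fin k → ℂ) × ℂ => (x.1, x.2.2.re)) (𝓝 0) (𝓝 0) := by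
        have : Continuous (fun x : (Fin k → ℂ) × (Fin k → ℂ) × ℂ => (x.1, x.2.2.re)) := by fun_prop
        exact this.tendsto' _ _ (by simp)
      filter_upwards [ht.eventually h] with x hx hσ
      have e3 : star x.2.2 = x.2.2 := congrArg (fun y => y.2.2) hσ
      have e2 : star x.1 = x.2.1 := congrArg (fun y => y.2.1) hσ
      have e1 : star x.2.1 = x.1 := congrArg (fun y => y.1) hσ
      have e4 : ((x.2.2.re : ℝ) : ℂ) = x.2.2 := Complex.conj_eq_iff_re.mp e3
      rw [iotaL_apply] at hx
      simp only [e4, e2] at hx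
      simp only [Prod.fst_star, Prod.snd_star, e1, e2, e3]
      have : Φ x = ((φ (x.1, x.2.2.re) : ℝ) : ℂ) := hx.symm
      rw [this]; simp)
  filter_upwards [h3] with x hx
  rw [sub_eq_zero] at hx
  simpa using hx

lemma rhoC_real {k : ℕ} {Φ : (Fin k → ℂ) × (Fin k → ℂ) × ℂ → ℂ}
    (h : ∀ᶠ x in 𝓝 (0 : (Fin k → ℂ) × (Fin k → ℂ) × ℂ),
      Φ x = star (Φ (star x.2.1, star x.1, star x.2.2))) :
    ∀ᶠ X in 𝓝 (0 : ((Fin k → ℂ) × ℂ) × ((Fin k → ℂ) × ℂ)),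
      rhoC Φ X = star (rhoC Φ (star X.2, star X.1)) := by
  have hπ : Tendsto (fun X : ((Fin k → ℂ) × ℂ) × ((Fin k → ℂ) × ℂ) =>
      (X.1.1, X.2.1, (2⁻¹ : ℂ) * (X.1.2 + X.2.2))) (𝓝 0) (𝓝 0) := by
    have : Continuous (fun X : ((Fin k → ℂ) × ℂ) × ((Fin k → ℂ) × ℂ) =>
      (X.1.1, X.2.1, (2⁻¹ : ℂ) * (X.1.2 + X.2.2))) := by fun_prop
    exact this.tendsto' _ _ (by simp)
  filter_upwards [hπ.eventually h] with X hX
  unfold rhoC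
  rw [hX]
  have : (star (2⁻¹ * (X.1.2 + X.2.2)) : ℂ) = 2⁻¹ * (star X.2.2 + star X.1.2) := by
    simp [add_comm]
  simp only [this, Prod.fst_star, Prod.snd_star, star_sub, star_mul', star_neg]
  simp
  ring

lemma rhoCN_eq_rhoC {k : ℕ} {φ : (Fin k → ℂ) × ℝ → ℝ} {Φ : (Fin k → ℂ) × (Fin k → ℂ) × ℂ → ℂ}
    (h : ∀ᶠ p in 𝓝 (0 : (Fin k → ℂ) × ℝ), ((φ p : ℝ) : ℂ) = Φ (iotaL k p)) :
    ∀ᶠ Z in 𝓝 (0 : (Fin k → ℂ) × ℂ), rhoCN φ Z = rhoC Φ (Z, star Z) := by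
  have ht : Tendsto (fun x : (Fin k → ℂ) × ℂ => (x.1, x.2.re)) (𝓝 0) (𝓝 0) := by
    have : Continuous (fun x : (Fin k → ℂ) × ℂ => (x.1, x.2.re)) := by fun_prop
    exact this.tendsto' _ _ (by simp)
  filter_upwards [ht.eventually h] with Z hZ
  unfold rhoCN rhoC
  rw [iotaL_apply] at hZ
  have e1 : (2⁻¹ : ℂ) * (Z.2 + star Z.2) = (Z.2.re : ℂ) := by
    apply Complex.ext <;> simp <;> ring
  have e2 : -(I / 2) * (Z.2 - star Z.2) = (Z.2.im : ℂ) := by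
    apply Complex.ext <;> simp <;> ring
  simp only [Prod.fst_star, Prod.snd_star]
  rw [e1, e2, ← hZ]
  simp

lemma levi_eq {k : ℕ} {φ : (Fin k → ℂ) × ℝ → ℝ} {Φ : (Fin k → ℂ) × (Fin k → ℂ) × ℂ → ℂ}
    (hΦ : AnalyticAt ℂ Φ 0)
    (h : ∀ᶠ p in 𝓝 (0 : (Fin k → ℂ) × ℝ), ((φ p : ℝ) : ℂ) = Φ (iotaL k p)) (i j : Fin k) :
    leviPhi φ i j = fderiv ℂ (fun x => fderiv ℂ Φ x (0, Pi.single j 1, 0)) 0 (Pi.single i 1, 0, 0) := by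
  unfold leviPhi
  have hι : Tendsto (iotaL k) (𝓝 0) (𝓝 0) := (iotaL k).continuous.tendsto' _ _ (map_zero _)
  have h1 : ∀ᶠ p in 𝓝 (0 : (Fin k → ℂ) × ℝ), wPhiDBar j (fun q => ((φ q : ℝ) : ℂ)) p
      = fderiv ℂ Φ (iotaL k p) (0, Pi.single j 1, 0) := by
    filter_upwards [h.eventually_nhds, hι.eventually hΦ.eventually_analyticAt] with p hp hp2
    exact (wPhi_iota hp2.differentiableAt hp j).1
  have := (wPhi_iota (p := 0) (g := fun x => fderiv ℂ Φ x (0, Pi.single j 1, 0))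
    (by rw [map_zero]; exact (analyticAt_fderiv_apply hΦ _).differentiableAt) h1 i).2
  rw [map_zero] at this
  exact this

end PhiFacts

section Implicit

lemma implicit_C {E₁ : Type*} [NormedAddCommGroup E₁] [NormedSpace ℂ E₁] [CompleteSpace E₁]
    {f : E₁ × ℂ → ℂ} {f' : E₁ × ℂ →L[ℂ] ℂ} {u : E₁ × ℂ} (hf : HasStrictFDerivAt f f' u)
    (hne : f' (0, 1) ≠ 0) :
    ∃ T : E₁ → ℂ, (∀ᶠ v in 𝓝 u, f v = f u ↔ T v.1 = v.2) ∧ Tendsto T (𝓝 u.1) (𝓝 u.2) ∧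
      (∀ᶠ x in 𝓝 u.1, f (x, T x) = f u) ∧
      ∃ L : E₁ →L[ℂ] ℂ, HasStrictFDerivAt T L u.1 ∧ ∀ v, f' (v, L v) = 0 := by
  have hinv : (f' ∘L .inr ℂ E₁ ℂ).IsInvertible := by
    refine ⟨ContinuousLinearEquiv.unitsEquivAut ℂ (Units.mk0 _ hne), ?_⟩
    ext
    simp
  have hT := hf.hasStrictFDerivAt_implicitFunctionOfProdDomain hinv
  have hap := hf.eventually_apply_implicitFunctionOfProdDomain hinv
  have htu : hf.implicitFunctionOfProdDomain hinv u.1 = u.2 :=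
    (hf.eventually_apply_eq_iff_implicitFunctionOfProdDomain hinv).self_of_nhds.mp rfl
  refine ⟨_, hf.eventually_apply_eq_iff_implicitFunctionOfProdDomain hinv,
    hf.tendsto_implicitFunctionOfProdDomain hinv, hap, _, hT, ?_⟩
  intro v
  have h1 : HasFDerivAt (fun x => (x, hf.implicitFunctionOfProdDomain hinv x)) _ u.1 :=
    (hasFDerivAt_id u.1).prodMk hT.hasFDerivAt
  have hf2 : HasFDerivAt f f' (u.1, hf.implicitFunctionOfProdDomain hinv u.1) := by
    rw [htu]; exact hf.hasFDerivAt
  have h2 := HasFDerivAt.comp u.1 hf2 h1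
  have h3 : HasFDerivAt (fun _ : E₁ => f u) (0 : E₁ →L[ℂ] ℂ) u.1 := hasFDerivAt_const _ _
  have h4 := h3.congr_of_eventuallyEq (f₁ := f ∘ (fun x => (x, hf.implicitFunctionOfProdDomain hinv x))) hap
  have h5 := congrArg (fun A : E₁ →L[ℂ] ℂ => A v) (h2.unique h4)
  simpa using h5

lemma exists_T {k : ℕ} {Φ : (Fin k → ℂ) × (Fin k → ℂ) × ℂ → ℂ}
    (hΦ : AnalyticAt ℂ Φ 0) (h0 : Φ 0 = 0) (h1 : fderiv ℂ Φ 0 = 0) :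
    ∃ T : ((Fin k → ℂ) × ℂ) × (Fin k → ℂ) → ℂ, T 0 = 0 ∧
      (∃ L : (((Fin k → ℂ) × ℂ) × (Fin k → ℂ)) →L[ℂ] ℂ, HasStrictFDerivAt T L 0 ∧ ∀ v, L v = v.1.2) ∧
      ∀ᶠ X in 𝓝 0, rhoC Φ X = 0 ↔ T (X.1, X.2.1) = X.2.2 := by
  have hρ : AnalyticAt ℂ (rhoC Φ) 0 := analyticAt_rhoC (by simpa [← Prod.zero_eq_mk] using hΦ)
  have hρ0 : rhoC Φ 0 = 0 := by simp [rhoC, ← Prod.zero_eq_mk, h0]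
  let A : ((((Fin k → ℂ) × ℂ) × (Fin k → ℂ)) × ℂ) →L[ℂ] (((Fin k → ℂ) × ℂ) × ((Fin k → ℂ) × ℂ)) :=
    LinearMap.toContinuousLinearMap
      { toFun := fun u => (u.1.1, (u.1.2, u.2))
        map_add' := fun u v => rfl
        map_smul' := fun c u => rfl }
  have hA : ∀ u, A u = (u.1.1, (u.1.2, u.2)) := fun u => rfl
  have hf : HasStrictFDerivAt (fun u => rhoC Φ (A u)) ((fderiv ℂ (rhoC Φ) 0).comp A) 0 := by
    have := hρ.hasStrictFDerivAt
    rw [← map_zero A] at this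
    exact this.comp (0 : (((Fin k → ℂ) × ℂ) × (Fin k → ℂ)) × ℂ) A.hasStrictFDerivAt
  have hfd : ∀ v, (fderiv ℂ (rhoC Φ) 0).comp A v = -(I / 2) * (v.1.1.2 - v.2) := by
    intro v
    rw [ContinuousLinearMap.comp_apply, hasFDerivAt_rhoC (by simpa [← Prod.zero_eq_mk] using hΦ.differentiableAt), hA]
    have : fderiv ℂ Φ (((0 : ((Fin k → ℂ) × ℂ) × ((Fin k → ℂ) × ℂ)).1.1), ((0 : ((Fin k → ℂ) × ℂ) × ((Fin k → ℂ) × ℂ)).2.1),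
      (2⁻¹ : ℂ) * ((0 : ((Fin k → ℂ) × ℂ) × ((Fin k → ℂ) × ℂ)).1.2 + (0 : ((Fin k → ℂ) × ℂ) × ((Fin k → ℂ) × ℂ)).2.2)) = 0 := by
      simpa [← Prod.zero_eq_mk] using h1
    rw [this]
    simp
  obtain ⟨T, hT1, -, -, L, hL, hL2⟩ := implicit_C hf (by rw [hfd]; simp)
  have hf0 : rhoC Φ (A 0) = 0 := by rw [map_zero, hρ0]
  refine ⟨T, ?_, ⟨L, hL, ?_⟩, ?_⟩
  · simpa using hT1.self_of_nhds
  · intro v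
    have h2 := hL2 v
    rw [hfd] at h2
    have h3 : -(I / 2) ≠ 0 := by simp
    exact (sub_eq_zero.mp ((mul_eq_zero.mp h2).resolve_left h3)).symm
  · have ht : Tendsto (fun X : ((Fin k → ℂ) × ℂ) × ((Fin k → ℂ) × ℂ) => ((X.1, X.2.1), X.2.2)) (𝓝 0) (𝓝 0) := by
      have : Continuous (fun X : ((Fin k → ℂ) × ℂ) × ((Fin k → ℂ) × ℂ) => ((X.1, X.2.1), X.2.2)) := by fun_prop
      exact this.tendsto' _ _ (by simp)
    filter_upwards [ht.eventually hT1] with X hX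
    rw [hf0, hA] at hX
    exact hX

end Implicit

section OpenSet

lemma segre_open {k m : ℕ} {Φ : (Fin k → ℂ) × (Fin k → ℂ) × ℂ → ℂ}
    (hΦ : AnalyticAt ℂ Φ 0) (h1 : fderiv ℂ Φ 0 = 0)
    (hreal : ∀ᶠ X in 𝓝 (0 : ((Fin k → ℂ) × ℂ) × ((Fin k → ℂ) × ℂ)),
      rhoC Φ X = star (rhoC Φ (star X.2, star X.1)))
    {T : ((Fin k → ℂ) × ℂ) × (Fin k → ℂ) → ℂ} (hT0 : T 0 = 0)
    {L : (((Fin k → ℂ) × ℂ) × (Fin k → ℂ)) →L[ℂ] ℂ} (hTL : HasStrictFDerivAt T L 0) (hL : ∀ v, L v = v.1.2)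
    (hT : ∀ᶠ X in 𝓝 0, rhoC Φ X = 0 ↔ T (X.1, X.2.1) = X.2.2)
    (e : Fin k → ℂ) (he : star e = e)
    (hlevi : fderiv ℂ (fun x => fderiv ℂ Φ x (0, e, 0)) 0 (e, 0, 0) ≠ 0)
    {α : (Fin k → ℂ) × ℂ → Fin m → ℂ} (hα : AnalyticAt ℂ α 0)
    (hS : ∀ᶠ X in 𝓝 (0 : ((Fin k → ℂ) × ℂ) × ((Fin k → ℂ) × ℂ)),
      rhoC Φ X = 0 → rhoC Φ (star X.2, 0) = 0 → α X.1 = 0) :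
    ∀ᶠ Z in 𝓝 0, α Z = 0 := by
  have hρ : AnalyticAt ℂ (rhoC Φ) 0 := analyticAt_rhoC (by simpa [← Prod.zero_eq_mk] using hΦ)
  let J : ℂ →L[ℂ] (((Fin k → ℂ) × ℂ) × (Fin k → ℂ)) :=
    LinearMap.toContinuousLinearMap
      { toFun := fun x => ((0, 0), x • e)
        map_add' := by intro x y; simp [add_smul]
        map_smul' := by intro c x; simp [mul_smul] }
  have hJ : ∀ x, J x = ((0, 0), x • e) := fun x => rfl
  set θ : ℂ → ℂ := fun x => T (J x) with hθ
  have hθ0 : θ 0 = 0 := by simp [hθ, hT0]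
  have hθd : HasStrictFDerivAt θ (0 : ℂ →L[ℂ] ℂ) 0 := by
    have h2 : HasStrictFDerivAt T L (J 0) := by rw [map_zero]; exact hTL
    have h3 := h2.comp (0 : ℂ) J.hasStrictFDerivAt
    have h4 : L.comp J = 0 := by ext; simp [hL, hJ]
    rw [h4] at h3
    exact h3
  have hθc : Tendsto θ (𝓝 0) (𝓝 0) := by
    have := hθd.continuousAt.tendsto
    rwa [hθ0] at this
  -- points of the Segre variety of 0
  set ζ : ℂ → (Fin k → ℂ) × ℂ := fun x => (x • e, θ x) with hζ
  have hζ0 : ζ 0 = 0 := by simp [hζ, hθ0]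
  have hζc : Tendsto ζ (𝓝 0) (𝓝 0) := by
    have h2 : Tendsto (fun x : ℂ => x • e) (𝓝 0) (𝓝 0) :=
      (continuous_id.smul continuous_const).tendsto' _ _ (by simp)
    exact h2.prodMk_nhds hθc
  have hζS : ∀ᶠ x in 𝓝 (0 : ℂ), rhoC Φ (star (ζ x), 0) = 0 := by
    have t1 : Tendsto (fun x => ((0 : (Fin k → ℂ) × ℂ), ζ x)) (𝓝 0) (𝓝 0) :=
      tendsto_const_nhds.prodMk_nhds hζc
    have t2 : Tendsto (fun x => (star (ζ x), (0 : (Fin k → ℂ) × ℂ))) (𝓝 0) (𝓝 0) := by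
      have : Tendsto (fun x => star (ζ x)) (𝓝 0) (𝓝 0) := by
        have h := (continuous_star.tendsto (0 : (Fin k → ℂ) × ℂ)).comp hζc
        rwa [star_zero] at h
      exact this.prodMk_nhds tendsto_const_nhds
    filter_upwards [t1.eventually hT, t2.eventually hreal] with x hx1 hx2
    rw [hx2]
    have : rhoC Φ (0, ζ x) = 0 := hx1.mpr rfl
    simpa using this
  set Z₀ : ℂ → (Fin k → ℂ) × ℂ := fun t => star (ζ (star t)) with hZ₀
  have hst : Tendsto (fun t : ℂ => star t) (𝓝 0) (𝓝 0) := by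
    simpa using continuous_star.tendsto (0 : ℂ)
  have hZc : Tendsto Z₀ (𝓝 0) (𝓝 0) := by
    have h := (continuous_star.tendsto (0 : (Fin k → ℂ) × ℂ)).comp (hζc.comp hst)
    rwa [star_zero] at h
  have hZS : ∀ᶠ t in 𝓝 (0 : ℂ), rhoC Φ (Z₀ t, 0) = 0 := hst.eventually hζS
  have hZX : Tendsto (fun t => (Z₀ t, (0 : (Fin k → ℂ) × ℂ))) (𝓝 0) (𝓝 0) :=
    hZc.prodMk_nhds tendsto_const_nhds
  -- nondegeneracy
  set P : ℂ → (Fin k → ℂ) × (Fin k → ℂ) × ℂ := fun t => (t • e, 0, 2⁻¹ * star (θ (star t))) with hP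
  have hP0 : P 0 = 0 := by simp [hP, hθ0]
  have hPc : Tendsto P (𝓝 0) (𝓝 0) := by
    have h2 : Tendsto (fun x : ℂ => x • e) (𝓝 0) (𝓝 0) :=
      (continuous_id.smul continuous_const).tendsto' _ _ (by simp)
    have h3 : Tendsto (fun t => 2⁻¹ * star (θ (star t))) (𝓝 0) (𝓝 0) := by
      simpa using ((continuous_star.tendsto (0 : ℂ)).comp (hθc.comp hst)).const_mul (2⁻¹ : ℂ)
    exact h2.prodMk_nhds (tendsto_const_nhds.prodMk_nhds h3)
  have hPd : HasDerivAt P (e, 0, 0) 0 := by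
    have h2 : HasDerivAt (fun x : ℂ => x • e) e 0 := by
      simpa using (hasDerivAt_id (0 : ℂ)).smul_const e
    have h3 : HasDerivAt θ 0 0 := by
      simpa using hθd.hasFDerivAt.hasDerivAt
    have h4 : HasDerivAt (fun t => star (θ (star t))) 0 0 := by
      have h5 : HasDerivAt θ 0 ((starRingEnd ℂ) 0) := by simpa using h3
      have h6 : HasDerivAt (fun t => star (θ (star t))) ((starRingEnd ℂ) 0) _ := h5.conj_conj
      rwa [map_zero, map_zero] at h6
    have h5 : HasDerivAt (fun t => 2⁻¹ * star (θ (star t))) 0 0 := by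
      simpa using h4.const_mul (2⁻¹ : ℂ)
    exact h2.prodMk ((hasDerivAt_const _ _).prodMk h5)
  have hd : AnalyticAt ℂ (fun x => fderiv ℂ Φ x (0, e, 0)) 0 := analyticAt_fderiv_apply hΦ _
  have hm : ∀ᶠ t in 𝓝[≠] (0 : ℂ), fderiv ℂ Φ (P t) (0, e, 0) ≠ 0 := by
    have h2 : HasFDerivAt (fun x => fderiv ℂ Φ x (0, e, 0)) (fderiv ℂ (fun x => fderiv ℂ Φ x (0, e, 0)) 0) (P 0) := by
      rw [hP0]; exact hd.differentiableAt.hasFDerivAt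
    exact (h2.comp_hasDerivAt (0 : ℂ) hPd).eventually_ne hlevi
  -- local vanishing
  have hloc : ∀ᶠ t in 𝓝[≠] (0 : ℂ), ∀ᶠ Z in 𝓝 (Z₀ t), α Z = 0 := by
    filter_upwards [hm, (hZX.eventually hS.eventually_nhds).filter_mono nhdsWithin_le_nhds,
      (hZX.eventually hρ.eventually_analyticAt).filter_mono nhdsWithin_le_nhds,
      (hPc.eventually hΦ.eventually_analyticAt).filter_mono nhdsWithin_le_nhds,
      hZS.filter_mono nhdsWithin_le_nhds] with t hmt hSt hρt hΦt hZt
    let A : (((Fin k → ℂ) × ℂ) × ℂ) →L[ℂ] (((Fin k → ℂ) × ℂ) × ((Fin k → ℂ) × ℂ)) :=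
      LinearMap.toContinuousLinearMap
        { toFun := fun u => (u.1, (u.2 • e, 0))
          map_add' := by intro u v; simp [add_smul]
          map_smul' := by intro c u; simp [mul_smul] }
    have hA : ∀ u, A u = (u.1, (u.2 • e, 0)) := fun u => rfl
    have hg : HasStrictFDerivAt (fun u : ((Fin k → ℂ) × ℂ) × ℂ => (u.1, ζ u.2)) A (Z₀ t, 0) := by
      have a1 : HasStrictFDerivAt (fun u : ((Fin k → ℂ) × ℂ) × ℂ => u.1) (ContinuousLinearMap.fst ℂ _ _) (Z₀ t, (0:ℂ)) :=
        hasStrictFDerivAt_fst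
      have a2 : HasStrictFDerivAt (fun u : ((Fin k → ℂ) × ℂ) × ℂ => u.2) (ContinuousLinearMap.snd ℂ _ _) (Z₀ t, (0:ℂ)) :=
        hasStrictFDerivAt_snd
      have a3 := a2.smul_const e
      have a4 : HasStrictFDerivAt (fun u : ((Fin k → ℂ) × ℂ) × ℂ => θ u.2) _ (Z₀ t, (0:ℂ)) :=
        HasStrictFDerivAt.comp (Z₀ t, (0:ℂ)) (g := θ) hθd a2
      have a5 := a1.prodMk (a3.prodMk a4)
      refine a5.congr_fderiv ?_
      apply ContinuousLinearMap.ext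
      intro v
      rw [hA]
      simp
    have hρs : HasStrictFDerivAt (rhoC Φ) (fderiv ℂ (rhoC Φ) (Z₀ t, 0)) (Z₀ t, ζ 0) := by
      rw [hζ0]; exact hρt.hasStrictFDerivAt
    have hf : HasStrictFDerivAt (fun u : ((Fin k → ℂ) × ℂ) × ℂ => rhoC Φ (u.1, ζ u.2))
        ((fderiv ℂ (rhoC Φ) (Z₀ t, 0)).comp A) (Z₀ t, 0) :=
      HasStrictFDerivAt.comp (Z₀ t, (0:ℂ)) (g := rhoC Φ) hρs hg
    have hPt : (((Z₀ t, (0 : (Fin k → ℂ) × ℂ)) : ((Fin k → ℂ) × ℂ) × ((Fin k → ℂ) × ℂ)).1.1,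
        ((Z₀ t, (0 : (Fin k → ℂ) × ℂ)) : ((Fin k → ℂ) × ℂ) × ((Fin k → ℂ) × ℂ)).2.1,
        2⁻¹ * (((Z₀ t, (0 : (Fin k → ℂ) × ℂ)) : ((Fin k → ℂ) × ℂ) × ((Fin k → ℂ) × ℂ)).1.2
          + ((Z₀ t, (0 : (Fin k → ℂ) × ℂ)) : ((Fin k → ℂ) × ℂ) × ((Fin k → ℂ) × ℂ)).2.2)) = P t := by
      simp [hZ₀, hζ, hP, he, star_smul]
    have hne : ((fderiv ℂ (rhoC Φ) (Z₀ t, 0)).comp A) (0, 1) ≠ 0 := by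
      rw [ContinuousLinearMap.comp_apply, hasFDerivAt_rhoC (by rw [hPt]; exact hΦt.differentiableAt), hPt, hA]
      simpa using hmt
    obtain ⟨x, -, hx2, hx3, -⟩ := implicit_C hf hne
    have hxc : Tendsto x (𝓝 (Z₀ t)) (𝓝 0) := hx2
    have hXc : Tendsto (fun Z => (Z, ζ (x Z))) (𝓝 (Z₀ t)) (𝓝 (Z₀ t, 0)) :=
      tendsto_id.prodMk_nhds (hζc.comp hxc)
    have hx3' : ∀ᶠ Z in 𝓝 (Z₀ t), rhoC Φ (Z, ζ (x Z)) = rhoC Φ (Z₀ t, ζ 0) := hx3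
    filter_upwards [hXc.eventually hSt, hx3', hxc.eventually hζS] with Z a1 a2 a3
    refine a1 ?_ a3
    rw [a2, hζ0, hZt]
  obtain ⟨r, hr, hball⟩ := Metric.eventually_nhds_iff_ball.mp hα.eventually_analyticAt
  have hmem : ∀ᶠ t in 𝓝[≠] (0 : ℂ), Z₀ t ∈ Metric.ball (0 : (Fin k → ℂ) × ℂ) r :=
    (hZc.eventually (Metric.ball_mem_nhds _ hr)).filter_mono nhdsWithin_le_nhds
  obtain ⟨t, ht1, ht2⟩ := (hloc.and hmem).exists
  have han : AnalyticOnNhd ℂ α (Metric.ball 0 r) := fun Z hZ => hball Z hZ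
  have hEq := han.eqOn_zero_of_preconnected_of_eventuallyEq_zero
    (convex_ball _ _).isPreconnected ht2 ht1
  filter_upwards [Metric.ball_mem_nhds (0 : (Fin k → ℂ) × ℂ) hr] with Z hZ
  exact hEq hZ

end OpenSet

section Core

lemma hzero_of_real {k m : ℕ} {φ : (Fin k → ℂ) × ℝ → ℝ} {Φ : (Fin k → ℂ) × (Fin k → ℂ) × ℂ → ℂ}
    (hΦ : AnalyticAt ℂ Φ 0) (h0 : Φ 0 = 0)
    (h : ∀ᶠ p in 𝓝 (0 : (Fin k → ℂ) × ℝ), ((φ p : ℝ) : ℂ) = Φ (iotaL k p))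
    {g : (Fin k → ℂ) × ℂ → Fin m → ℂ}
    {R R2 : ((Fin k → ℂ) × ℂ) × ((Fin k → ℂ) × ℂ) → Fin m → ℂ} (hR : AnalyticAt ℂ R 0)
    (hR2 : AnalyticAt ℂ R2 0)
    (hRg : ∀ᶠ Z in 𝓝 (0 : (Fin k → ℂ) × ℂ), g Z = R (Z, star Z))
    (hR2g : ∀ᶠ Z in 𝓝 (0 : (Fin k → ℂ) × ℂ), star (g Z) = R2 (Z, star Z))
    {α : (Fin k → ℂ) × ℂ → Fin m → ℂ} (hα : AnalyticAt ℂ α 0)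
    (hαM : ∀ᶠ p in 𝓝 (0 : (Fin k → ℂ) × ℂ), p ∈ MsetN φ → (∑ j, α p j * g p j).re = 0) :
    ∀ᶠ x in 𝓝 0, ∑ j, α (parC Φ x).1 j * R (parC Φ x) j
      + ∑ j, star (α (star (parC Φ x).2)) j * R2 (parC Φ x) j = 0 := by
  have hp := continuousAt_parC hΦ
  have hp0 := parC_zero h0
  have hfst : AnalyticAt ℂ (fun X : ((Fin k → ℂ) × ℂ) × ((Fin k → ℂ) × ℂ) => X.1) 0 :=
    analyticAt_of_linear _ (by intro X Y; simp) (by intro c X; simp) _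
  have hsnd : AnalyticAt ℂ (fun X : ((Fin k → ℂ) × ℂ) × ((Fin k → ℂ) × ℂ) => X.2) 0 :=
    analyticAt_of_linear _ (by intro X Y; simp) (by intro c X; simp) _
  have hαs : AnalyticAt ℂ (fun X : ((Fin k → ℂ) × ℂ) × ((Fin k → ℂ) × ℂ) => star (α (star X.2))) 0 :=
    AnalyticAt.fun_comp (g := fun Z => star (α (star Z))) (f := fun X : ((Fin k → ℂ) × ℂ) × ((Fin k → ℂ) × ℂ) => X.2)
      (analyticAt_star_star hα) hsnd
  have hαf : AnalyticAt ℂ (fun X : ((Fin k → ℂ) × ℂ) × ((Fin k → ℂ) × ℂ) => α X.1) 0 :=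
    AnalyticAt.fun_comp (g := α) (f := fun X : ((Fin k → ℂ) × ℂ) × ((Fin k → ℂ) × ℂ) => X.1) hα hfst
  have hA : AnalyticAt ℂ (fun X => ∑ j, α X.1 j * R X j + ∑ j, star (α (star X.2)) j * R2 X j) 0 := by
    refine AnalyticAt.fun_add (Finset.analyticAt_fun_sum _ fun j _ => ?_)
      (Finset.analyticAt_fun_sum _ fun j _ => ?_)
    · exact (analyticAt_pi_iff.mp hαf j).fun_mul (analyticAt_pi_iff.mp hR j)
    · exact (analyticAt_pi_iff.mp hαs j).fun_mul (analyticAt_pi_iff.mp hR2 j)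
  have hAp : AnalyticAt ℂ (fun x => ∑ j, α (parC Φ x).1 j * R (parC Φ x) j
      + ∑ j, star (α (star (parC Φ x).2)) j * R2 (parC Φ x) j) 0 := by
    rw [← hp0] at hA
    exact AnalyticAt.fun_comp (g := fun X => ∑ j, α X.1 j * R X j + ∑ j, star (α (star X.2)) j * R2 X j) hA hp
  refine eventually_zero_of_real
    (fun x : (Fin k → ℂ) × (Fin k → ℂ) × ℂ => (star x.2.1, star x.1, star x.2.2))
    (by intro x y; simp) (by intro c x; simp [star_smul])
    (by intro x; simp only [Prod.norm_def, norm_star]; rw [max_left_comm])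
    (by intro x; simp) _ hAp ?_
  have ht : Tendsto (fun x : (Fin k → ℂ) × (Fin k → ℂ) × ℂ => (x.1, x.2.2.re)) (𝓝 0) (𝓝 0) := by
    have : Continuous (fun x : (Fin k → ℂ) × (Fin k → ℂ) × ℂ => (x.1, x.2.2.re)) := by fun_prop
    exact this.tendsto' _ _ (by simp)
  have hq : Tendsto (fun x => (parC Φ x).1) (𝓝 0) (𝓝 0) := by
    have h1 := (continuous_fst.continuousAt.comp hp.continuousAt).tendsto
    simpa [hp0, Function.comp_def] using h1
  filter_upwards [ht.eventually h, hq.eventually hRg, hq.eventually hR2g, hq.eventually hαM]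
    with x hx hx1 hx2 hx3 hσ
  have e3 : star x.2.2 = x.2.2 := congrArg (fun y => y.2.2) hσ
  have e2 : star x.1 = x.2.1 := congrArg (fun y => y.2.1) hσ
  have e4 : ((x.2.2.re : ℝ) : ℂ) = x.2.2 := Complex.conj_eq_iff_re.mp e3
  rw [iotaL_apply] at hx
  simp only [e4, e2] at hx
  have hxx : Φ x = ((φ (x.1, x.2.2.re) : ℝ) : ℂ) := hx.symm
  have him : x.2.2.im = 0 := by rw [← e4]; simp
  have hstar : (parC Φ x).2 = star (parC Φ x).1 := by
    unfold parC
    rw [hxx]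
    refine Prod.ext (by simp [e2]) ?_
    simp only [Prod.snd_star, star_add, e3, star_mul']
    simp
    ring
  have hM : (parC Φ x).1 ∈ MsetN φ := by
    simp [MsetN, parC, hxx, him]
  have hre := hx3 hM
  have hpar : parC Φ x = ((parC Φ x).1, star (parC Φ x).1) := by
    rw [← hstar]
  rw [hstar, star_star]
  have r1 : R (parC Φ x) = g (parC Φ x).1 := by rw [hx1, ← hpar]
  have r2 : R2 (parC Φ x) = star (g (parC Φ x).1) := by rw [hx2, ← hpar]
  rw [r1, r2]
  have : ∑ j, star (α (parC Φ x).1) j * star (g (parC Φ x).1) j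
      = (starRingEnd ℂ) (∑ j, α (parC Φ x).1 j * g (parC Φ x).1 j) := by
    simp [map_sum]
  rw [this, Complex.add_conj, hre]
  simp

lemma core {k m κ : ℕ} (hk : 0 < k) {φ : (Fin k → ℂ) × ℝ → ℝ} (hφa : AnalyticAt ℝ φ 0) (hφ0 : φ 0 = 0)
    (hφ1 : fderiv ℝ φ 0 = 0) (hφpd : (leviPhi φ).PosDef)
    {g : (Fin k → ℂ) × ℂ → Fin m → ℂ} (hg : AnalyticAt ℝ g 0)
    (hspan : Submodule.span ℂ {v : Fin m → ℂ | ∃ ℓ : List (Fin k), ℓ.length ≤ κ ∧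
        (ℓ.foldr (LopN φ) g) 0 = v} = ⊤)
    {α : (Fin k → ℂ) × ℂ → Fin m → ℂ} (hα : AnalyticAt ℂ α 0)
    (hαM : ∀ᶠ p in 𝓝 (0 : (Fin k → ℂ) × ℂ), p ∈ MsetN φ → (∑ j, α p j * g p j).re = 0)
    (hαO : α =O[𝓝 0] fun Z => ‖Z‖ ^ (2 * κ + 1)) :
    ∀ᶠ Z in 𝓝 0, α Z = 0 := by
  obtain ⟨Φ, hΦ, hΦφ⟩ := exists_Phi hφa
  have hΦ0 := Phi_zero hφ0 hΦφ
  have hΦ1 := Phi_fderiv_zero hφa hφ1 hΦ hΦφ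
  have hreal := rhoC_real (Phi_real hΦ hΦφ)
  have hρN := rhoCN_eq_rhoC hΦφ
  have hρ : AnalyticAt ℂ (rhoC Φ) 0 := analyticAt_rhoC (by simpa [← Prod.zero_eq_mk] using hΦ)
  obtain ⟨T, hT0, ⟨L, hTL, hL⟩, hT⟩ := exists_T hΦ hΦ0 hΦ1
  obtain ⟨K, s, hs, hK⟩ := hTL.exists_lipschitzOnWith
  obtain ⟨R, hR, hRg⟩ := exists_complexify g hg
  have hg2 : AnalyticAt ℝ (fun Z => star (g Z)) 0 := by
    refine analyticAt_pi_iff.mpr fun j => ?_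
    exact (Complex.conjCLE.toContinuousLinearMap.analyticAt _).fun_comp (analyticAt_pi_iff.mp hg j)
  obtain ⟨R2, hR2, hR2g⟩ := exists_complexify (fun Z => star (g Z)) hg2
  have hspan' : Submodule.span ℂ {v : Fin m → ℂ | ∃ ℓ : List (Fin k), ℓ.length ≤ κ ∧
        (ℓ.foldr (LC (rhoC Φ)) R) 0 = v} = ⊤ := by
    rw [← hspan]
    congr 1
    ext v
    refine exists_congr fun ℓ => and_congr_right fun _ => ?_
    have := (foldr_LC_complexify hρ hρN hR hRg ℓ).self_of_nhds
    rw [star_zero, ← Prod.zero_eq_mk] at this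
    rw [this]
  have hzero := hzero_of_real hΦ hΦ0 hΦφ hR hR2 hRg hR2g hα hαM
  have step := segre_step hΦ hΦ0 hR hR2 hα hzero hspan' hs hK hT
  let j0 : Fin k := ⟨0, hk⟩
  have hlevi : fderiv ℂ (fun x => fderiv ℂ Φ x (0, Pi.single j0 1, 0)) 0 (Pi.single j0 1, 0, 0) ≠ 0 := by
    rw [← levi_eq hΦ hΦφ]
    exact (hφpd.diag_pos).ne'
  refine segre_open hΦ hΦ1 hreal hT0 hTL hL hT (Pi.single j0 1) ?_ hlevi hα ?_
  · ext i
    by_cases hi : i = j0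
    · subst hi; simp
    · simp [hi]
  · have t1 : Tendsto (fun X : ((Fin k → ℂ) × ℂ) × ((Fin k → ℂ) × ℂ) => (star X.2, (0 : (Fin k → ℂ) × ℂ)))
        (𝓝 0) (𝓝 0) := by
      have : Continuous (fun X : ((Fin k → ℂ) × ℂ) × ((Fin k → ℂ) × ℂ) => (star X.2, (0 : (Fin k → ℂ) × ℂ))) := by
        fun_prop
      exact this.tendsto' _ _ (by simp)
    filter_upwards [step, t1.eventually step] with X h1 h2 h3 h4
    have h5 : α =O[𝓝 (star X.2)] fun Z => ‖Z - star X.2‖ ^ (κ + 1) := by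
      refine h2 h4 (κ + 1) ?_
      have e : κ + 1 + κ = 2 * κ + 1 := by ring
      simpa [e] using hαO
    have h6 := h1 h3 1 (by simpa [add_comm] using h5)
    have h7 := h6.eq_zero_of_norm_pow
    exact h7 one_ne_zero

end Core

section Final

lemma isBigO_of_jets {E F : Type*} [NormedAddCommGroup E] [NormedSpace ℂ E]
    [NormedAddCommGroup F] [NormedSpace ℂ F] [CompleteSpace F] {f : E → F} (hf : AnalyticAt ℂ f 0) {n : ℕ}
    (h : ∀ i, i ≤ n → iteratedFDeriv ℂ i f 0 = 0) : f =O[𝓝 0] fun Z => ‖Z‖ ^ (n + 1) := by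
  obtain ⟨p, hp⟩ := hf
  have h1 := hp.isBigO_sub_partialSum_pow (n + 1)
  obtain ⟨r, hr⟩ := hp
  refine h1.congr_left fun y => ?_
  have : p.partialSum (n + 1) y = 0 := by
    unfold FormalMultilinearSeries.partialSum
    refine Finset.sum_eq_zero fun i hi => ?_
    have h2 := hr.factorial_smul y i
    rw [h i (by simpa [Nat.lt_succ_iff] using hi)] at h2
    have h3 : i.factorial ≠ 0 := Nat.factorial_ne_zero i
    have h4 : ((i.factorial : ℕ) : ℂ) • (p i fun _ => y) = 0 := by
      rw [Nat.cast_smul_eq_nsmul]; simpa using h2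
    exact (smul_eq_zero.mp h4).resolve_left (by exact_mod_cast h3)
  rw [this, zero_add, sub_zero]

lemma analyticAt_wDer {E F : Type*} [NormedAddCommGroup E] [NormedSpace ℂ E]
    [NormedAddCommGroup F] [NormedSpace ℂ F] [CompleteSpace F] {f : E → F} {p : E} (hf : AnalyticAt ℝ f p) (v : E) :
    AnalyticAt ℝ (wDer v f) p := by
  have h1 : ∀ w : E, AnalyticAt ℝ (fun q => fderiv ℝ f q w) p := fun w =>
    AnalyticAt.fun_comp (g := fun A : E →L[ℝ] F => A w)
      ((ContinuousLinearMap.apply ℝ F w).analyticAt _) hf.fderiv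
  have h2 : ∀ c : ℂ, ∀ G : E → F, AnalyticAt ℝ G p → AnalyticAt ℝ (fun q => c • G q) p := by
    intro c G hG
    exact AnalyticAt.fun_comp (g := fun x : F => c • x)
      (((c • ContinuousLinearMap.id ℂ F).restrictScalars ℝ).analyticAt _) hG
  exact h2 _ _ ((h1 v).fun_sub (h2 _ _ (h1 _)))

lemma analyticAt_rhoCN {k : ℕ} {ψ : (Fin k → ℂ) × ℝ → ℝ} (hψ : AnalyticAt ℝ ψ 0) :
    AnalyticAt ℝ (rhoCN ψ) 0 := by
  have h1 : AnalyticAt ℝ (fun Z : (Fin k → ℂ) × ℂ => (Z.1, Z.2.re)) 0 :=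
    ((ContinuousLinearMap.fst ℝ (Fin k → ℂ) ℂ).prod
      (Complex.reCLM.comp (ContinuousLinearMap.snd ℝ (Fin k → ℂ) ℂ))).analyticAt 0
  have h2 : AnalyticAt ℝ (fun Z : (Fin k → ℂ) × ℂ => ψ (Z.1, Z.2.re)) 0 :=
    AnalyticAt.fun_comp (g := ψ) (by simpa [← Prod.zero_eq_mk] using hψ) h1
  have h3 : AnalyticAt ℝ (fun Z : (Fin k → ℂ) × ℂ => Z.2.im) 0 :=
    (Complex.imCLM.comp (ContinuousLinearMap.snd ℝ (Fin k → ℂ) ℂ)).analyticAt 0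
  exact AnalyticAt.fun_comp (g := fun x : ℝ => (x : ℂ)) (Complex.ofRealCLM.analyticAt _) (h3.fun_sub h2)

lemma analyticAt_G {N N' : ℕ} {ψ : (Fin (N' - 1) → ℂ) × ℝ → ℝ} (hψ : AnalyticAt ℝ ψ 0)
    {H : (Fin (N - 1) → ℂ) × ℂ → (Fin (N' - 1) → ℂ) × ℂ}
    (hHa : AnalyticAt ℂ H 0) (hH0 : H 0 = 0) : AnalyticAt ℝ (fun p => GgradN N' ψ (H p)) 0 := by
  refine analyticAt_pi_iff.mpr fun j => ?_
  have h1 := analyticAt_wDer (analyticAt_rhoCN hψ) (gradDir N' j)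
  rw [← hH0] at h1
  exact AnalyticAt.fun_comp (g := wDer (gradDir N' j) (rhoCN ψ)) h1 (hHa.restrictScalars (𝕜 := ℝ))

/-- Finite dimensionality of a space of germs of analytic functions determined by finite jets. -/
lemma finite_of_jets {E F : Type*} [NormedAddCommGroup E] [NormedSpace ℂ E] [FiniteDimensional ℂ E]
    [NormedAddCommGroup F] [NormedSpace ℂ F] [FiniteDimensional ℂ F] (n : ℕ)
    (S : Submodule ℝ (Filter.Germ (𝓝 (0 : E)) F))
    (hS : ∀ g ∈ S, ∃ α : E → F, g = (α : Filter.Germ (𝓝 (0 : E)) F) ∧ AnalyticAt ℂ α 0)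
    (hinj : ∀ α : E → F, (α : Filter.Germ (𝓝 (0 : E)) F) ∈ S → AnalyticAt ℂ α 0 →
      (∀ i, i ≤ n → iteratedFDeriv ℂ i α 0 = 0) → ∀ᶠ Z in 𝓝 0, α Z = 0) :
    FiniteDimensional ℝ S := by
  choose rep hrep1 hrep2 using fun g : S => hS g.1 g.2
  let b := Module.finBasis ℂ E
  have hcongr : ∀ (i : ℕ) (f g : E → F), f =ᶠ[𝓝 0] g → iteratedFDeriv ℂ i f 0 = iteratedFDeriv ℂ i g 0 :=
    fun i f g h => (h.iteratedFDeriv ℂ i).self_of_nhds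
  have hadd : ∀ (s t : S) (i : ℕ), iteratedFDeriv ℂ i (rep (s + t)) 0
      = iteratedFDeriv ℂ i (rep s) 0 + iteratedFDeriv ℂ i (rep t) 0 := by
    intro s t i
    have h1 : rep (s + t) =ᶠ[𝓝 0] rep s + rep t := by
      rw [← Filter.Germ.coe_eq, Filter.Germ.coe_add, ← hrep1, ← hrep1, ← hrep1]
      rfl
    rw [hcongr i _ _ h1]
    exact iteratedFDeriv_add_apply (hrep2 s).contDiffAt (hrep2 t).contDiffAt
  have hsmul : ∀ (c : ℝ) (s : S) (i : ℕ), iteratedFDeriv ℂ i (rep (c • s)) 0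
      = (c : ℂ) • iteratedFDeriv ℂ i (rep s) 0 := by
    intro c s i
    have h1 : rep (c • s) =ᶠ[𝓝 0] (c : ℂ) • rep s := by
      rw [← Filter.Germ.coe_eq, ← hrep1]
      have : ((c : ℂ) • rep s) = c • rep s := by
        ext x; simp
      rw [this, Filter.Germ.coe_smul, ← hrep1]
      rfl
    rw [hcongr i _ _ h1]
    exact iteratedFDeriv_const_smul_apply (hrep2 s).contDiffAt
  let J : S →ₗ[ℝ] ((Σ i : Fin (n + 1), (Fin i → Fin (Module.finrank ℂ E))) → F) :=
    { toFun := fun s q => iteratedFDeriv ℂ q.1 (rep s) 0 (fun l => b (q.2 l))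
      map_add' := by
        intro s t; ext q
        rw [hadd]; rfl
      map_smul' := by
        intro c s; ext q
        rw [hsmul]
        simp }
  have : FiniteDimensional ℝ F := FiniteDimensional.complexToReal F
  refine FiniteDimensional.of_injective J ?_
  rw [← LinearMap.ker_eq_bot, LinearMap.ker_eq_bot']
  intro s hs
  have h1 : ∀ i, i ≤ n → iteratedFDeriv ℂ i (rep s) 0 = 0 := by
    intro i hi
    apply ContinuousMultilinearMap.toMultilinearMap_injective
    refine Module.Basis.ext_multilinear (fun _ => b) fun v => ?_
    exact congrFun hs ⟨⟨i, Nat.lt_succ_of_le hi⟩, v⟩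
  have h2 := hinj (rep s) (by rw [← hrep1]; exact s.2) (hrep2 s) h1
  apply Subtype.ext
  rw [hrep1 s]
  exact Filter.Germ.coe_eq.mpr h2

end Final

/-- for a `κ`-nondegenerate holomorphic embedding `H` of a strictly
pseudoconvex hypersurface `M ⊂ ℂᴺ` into a hypersurface `M' ⊂ ℂᴺ'`, the space of germs
of infinitesimal deformations of `H` is finite-dimensional, and each infinitesimal
deformation is determined by its `2κ`-jet at `0`. -/
theorem stmt_7 (N N' κ : ℕ) (hN : 2 ≤ N) (hNN' : N ≤ N') (hκ : 1 ≤ κ)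
    (φ : (Fin (N - 1) → ℂ) × ℝ → ℝ) (hφa : AnalyticAt ℝ φ 0) (hφ0 : φ 0 = 0)
    (hφ1 : fderiv ℝ φ 0 = 0) (hφpd : (leviPhi φ).PosDef)
    (ψ : (Fin (N' - 1) → ℂ) × ℝ → ℝ) (hψa : AnalyticAt ℝ ψ 0) (hψ0 : ψ 0 = 0)
    (hψ1 : fderiv ℝ ψ 0 = 0)
    (H : (Fin (N - 1) → ℂ) × ℂ → (Fin (N' - 1) → ℂ) × ℂ)
    (hHa : AnalyticAt ℂ H 0) (hH0 : H 0 = 0)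
    (hHinj : Function.Injective (fderiv ℂ H 0))
    (hHmap : ∀ᶠ p in 𝓝 (0 : (Fin (N - 1) → ℂ) × ℂ), p ∈ MsetN φ → H p ∈ MsetN ψ)
    (hHnd : Submodule.span ℂ
      {v : Fin N' → ℂ | ∃ ℓ : List (Fin (N - 1)), ℓ.length ≤ κ ∧
        (ℓ.foldr (LopN φ) (fun p => GgradN N' ψ (H p))) 0 = v} = ⊤) :
    (∃ S : Submodule ℝ
        (Filter.Germ (𝓝 (0 : (Fin (N - 1) → ℂ) × ℂ)) (Fin N' → ℂ)),
      (S : Set (Filter.Germ (𝓝 (0 : (Fin (N - 1) → ℂ) × ℂ)) (Fin N' → ℂ)))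
        = {g | ∃ α : (Fin (N - 1) → ℂ) × ℂ → Fin N' → ℂ,
            g = (α : Filter.Germ (𝓝 (0 : (Fin (N - 1) → ℂ) × ℂ)) (Fin N' → ℂ))
            ∧ AnalyticAt ℂ α 0 ∧ α 0 = 0
            ∧ ∀ᶠ p in 𝓝 (0 : (Fin (N - 1) → ℂ) × ℂ), p ∈ MsetN φ →
                (∑ j : Fin N', α p j * GgradN N' ψ (H p) j).re = 0}
      ∧ FiniteDimensional ℝ S)
    ∧ (∀ α β : (Fin (N - 1) → ℂ) × ℂ → Fin N' → ℂ,
        (AnalyticAt ℂ α 0 ∧ α 0 = 0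
          ∧ ∀ᶠ p in 𝓝 (0 : (Fin (N - 1) → ℂ) × ℂ), p ∈ MsetN φ →
              (∑ j : Fin N', α p j * GgradN N' ψ (H p) j).re = 0) →
        (AnalyticAt ℂ β 0 ∧ β 0 = 0
          ∧ ∀ᶠ p in 𝓝 (0 : (Fin (N - 1) → ℂ) × ℂ), p ∈ MsetN φ →
              (∑ j : Fin N', β p j * GgradN N' ψ (H p) j).re = 0) →
        (∀ n : ℕ, n ≤ 2 * κ → iteratedFDeriv ℂ n α 0 = iteratedFDeriv ℂ n β 0) →
        ∀ᶠ p in 𝓝 (0 : (Fin (N - 1) → ℂ) × ℂ), α p = β p) := by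
  have hk : 0 < N - 1 := by omega
  have hg := analyticAt_G (N := N) hψa hHa hH0
  have hcore : ∀ α : (Fin (N - 1) → ℂ) × ℂ → Fin N' → ℂ, AnalyticAt ℂ α 0 →
      (∀ᶠ p in 𝓝 (0 : (Fin (N - 1) → ℂ) × ℂ), p ∈ MsetN φ →
        (∑ j : Fin N', α p j * GgradN N' ψ (H p) j).re = 0) →
      (∀ i, i ≤ 2 * κ → iteratedFDeriv ℂ i α 0 = 0) → ∀ᶠ Z in 𝓝 0, α Z = 0 :=
    fun α hα hαM hj => core hk hφa hφ0 hφ1 hφpd hg hHnd hα hαM (isBigO_of_jets hα hj)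
  constructor
  · let S : Submodule ℝ (Filter.Germ (𝓝 (0 : (Fin (N - 1) → ℂ) × ℂ)) (Fin N' → ℂ)) :=
      { carrier := {g | ∃ α : (Fin (N - 1) → ℂ) × ℂ → Fin N' → ℂ,
            g = (α : Filter.Germ (𝓝 (0 : (Fin (N - 1) → ℂ) × ℂ)) (Fin N' → ℂ))
            ∧ AnalyticAt ℂ α 0 ∧ α 0 = 0
            ∧ ∀ᶠ p in 𝓝 (0 : (Fin (N - 1) → ℂ) × ℂ), p ∈ MsetN φ →
                (∑ j : Fin N', α p j * GgradN N' ψ (H p) j).re = 0}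
        add_mem' := by
          rintro _ _ ⟨α, rfl, a1, a2, a3⟩ ⟨β, rfl, b1, b2, b3⟩
          refine ⟨α + β, (Filter.Germ.coe_add α β).symm, a1.add b1, by simp [a2, b2], ?_⟩
          filter_upwards [a3, b3] with p ha hb hp
          have e1 : ∑ j : Fin N', (α + β) p j * GgradN N' ψ (H p) j
              = ∑ j : Fin N', α p j * GgradN N' ψ (H p) j + ∑ j : Fin N', β p j * GgradN N' ψ (H p) j := by
            rw [← Finset.sum_add_distrib]
            exact Finset.sum_congr rfl fun j _ => add_mul _ _ _
          rw [e1, Complex.add_re, ha hp, hb hp, add_zero]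
        zero_mem' := by
          refine ⟨0, rfl, analyticAt_const, rfl, ?_⟩
          filter_upwards with p hp
          simp
        smul_mem' := by
          rintro c _ ⟨α, rfl, a1, a2, a3⟩
          refine ⟨c • α, (Filter.Germ.coe_smul c α).symm, ?_, by simp [a2], ?_⟩
          · have e1 : c • α = fun p => (c : ℂ) • α p := by
              ext p j; simp
            rw [e1]
            exact analyticAt_const.fun_smul a1
          · filter_upwards [a3] with p ha hp
            have e1 : ∑ j : Fin N', (c • α) p j * GgradN N' ψ (H p) j
                = (c : ℂ) * ∑ j : Fin N', α p j * GgradN N' ψ (H p) j := by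
              rw [Finset.mul_sum]
              refine Finset.sum_congr rfl fun j _ => ?_
              simp [mul_assoc]
            rw [e1, Complex.re_ofReal_mul, ha hp, mul_zero] }
    refine ⟨S, rfl, finite_of_jets (2 * κ) S ?_ ?_⟩
    · rintro g ⟨α, h1, h2, -, -⟩
      exact ⟨α, h1, h2⟩
    · rintro α ⟨β, h1, -, -, h4⟩ hα hj
      refine hcore α hα ?_ hj
      filter_upwards [h4, Filter.Germ.coe_eq.mp h1] with p hp hpe hpM
      rw [hpe]
      exact hp hpM
  · rintro α β ⟨a1, -, a3⟩ ⟨b1, -, b3⟩ hj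
    have h1 := hcore (α - β) (a1.sub b1) (by
      filter_upwards [a3, b3] with p ha hb hp
      have e1 : ∑ j : Fin N', (α - β) p j * GgradN N' ψ (H p) j
          = ∑ j : Fin N', α p j * GgradN N' ψ (H p) j - ∑ j : Fin N', β p j * GgradN N' ψ (H p) j := by
        rw [← Finset.sum_sub_distrib]
        exact Finset.sum_congr rfl fun j _ => sub_mul _ _ _
      rw [e1, Complex.sub_re, ha hp, hb hp, sub_zero]) (by
      intro i hi
      rw [iteratedFDeriv_sub_apply a1.contDiffAt b1.contDiffAt, hj i hi, sub_self])
    filter_upwards [h1] with p hp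
    exact sub_eq_zero.mp hp
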